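/- arXiv:1712.06392 — 2 statements merged into one kernel-verified Lean document; each statement's English description precedes it below -/
import Mathlib

section
/- Let K be a field and R = K[x1,…,x5]. There are exactly 92 monomial ideals J ⊆ R that are strongly stable and satisfy dim_K R/J = 12. -/
open MvPolynomial

/-- A monomial ideal `J` is strongly stable if, for every monomial `xᵅ ∈ J` and indices
`i < k` with `x_i ∣ xᵅ`, the monomial `(xᵅ / x_i) · x_k` also lies in `J`. -/
def StronglyStable {n : ℕ} {K : Type} [Field K] (J : Ideal (MvPolynomial (Fin n) K)) : Prop :=
  ∀ α : Fin n →₀ ℕ, (monomial α (1 : K)) ∈ J →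
    ∀ i k : Fin n, i < k → α i ≠ 0 →
      (monomial (α - Finsupp.single i 1 + Finsupp.single k 1) (1 : K)) ∈ J

/-- An ideal of `K[x₁,…,xₙ]` is a monomial ideal if it is generated by monomials. -/
def IsMonomialIdeal {n : ℕ} {K : Type} [Field K] (J : Ideal (MvPolynomial (Fin n) K)) : Prop :=
  ∃ S : Set (Fin n →₀ ℕ), J = Ideal.span ((fun α => monomial α (1 : K)) '' S)

/-- Exponent vectors of monomials in five variables. -/
abbrev Exponent := ℕ × ℕ × ℕ × ℕ × ℕ

/-- The exponents obtained by dividing by `x₁`, or by replacing one factor `x_{k+1}` by `x_k`. -/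
def lowerMoves : Exponent → List Exponent
  | (a, b, c, d, e) =>
    (if a = 0 then [] else [(a - 1, b, c, d, e)]) ++
    (if b = 0 then [] else [(a + 1, b - 1, c, d, e)]) ++
    (if c = 0 then [] else [(a, b + 1, c - 1, d, e)]) ++
    (if d = 0 then [] else [(a, b, c + 1, d - 1, e)]) ++
    (if e = 0 then [] else [(a, b, c, d + 1, e - 1)])

/-- A list containing every exponent that has the given one among its `lowerMoves`. -/
def upperMoves : Exponent → List Exponent
  | (a, b, c, d, e) =>
    [(a + 1, b, c, d, e), (a - 1, b + 1, c, d, e), (a, b - 1, c + 1, d, e),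
      (a, b, c - 1, d + 1, e), (a, b, c, d - 1, e + 1)]

/-- A weight that strictly decreases along `lowerMoves`. -/
def exponentWeight : Exponent → ℕ
  | (a, b, c, d, e) => a + 16 * (b + 16 * (c + 16 * (d + 16 * e)))

/-- The exponents of maximal weight by which a lower set, given as a list, can be extended. -/
def extensions (t : List Exponent) : List Exponent :=
  ((0, 0, 0, 0, 0) :: t.flatMap upperMoves).dedup.filter fun m =>
    t.all (fun x => x ≠ m ∧ exponentWeight x ≤ exponentWeight m) && (lowerMoves m).all (· ∈ t)

/-- All lower sets with `n` elements, listed by adding elements in order of weight. -/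
def lowerLists : ℕ → List (List Exponent)
  | 0 => [[]]
  | n + 1 => (lowerLists n).flatMap fun t => (extensions t).map (· :: t)

/-- A set of exponents is lower if it is stable under `lowerMoves`. -/
def IsLowerExponents (S : Set Exponent) : Prop :=
  ∀ x ∈ S, ∀ y ∈ lowerMoves x, y ∈ S

lemma exponentWeight_lt_of_mem_lowerMoves {x y : Exponent} (h : y ∈ lowerMoves x) :
    exponentWeight y < exponentWeight x := by
  obtain ⟨a, b, c, d, e⟩ := x
  simp only [lowerMoves, List.mem_append] at h
  rcases h with (((h | h) | h) | h) | h <;> split_ifs at h with h0 <;>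
    simp only [List.not_mem_nil, List.mem_singleton] at h <;> subst h <;>
    simp only [exponentWeight] <;> omega

lemma mem_upperMoves_of_mem_lowerMoves {x y : Exponent} (h : y ∈ lowerMoves x) :
    x ∈ upperMoves y := by
  obtain ⟨a, b, c, d, e⟩ := x
  simp only [lowerMoves, List.mem_append] at h
  rcases h with (((h | h) | h) | h) | h <;> split_ifs at h with h0 <;>
    simp only [List.not_mem_nil, List.mem_singleton] at h <;> subst h <;>
    simp [upperMoves, Nat.sub_add_cancel (Nat.pos_of_ne_zero h0)]

lemma exists_mem_lowerMoves {x : Exponent} (h : x ≠ (0, 0, 0, 0, 0)) :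
    ∃ y, y ∈ lowerMoves x := by
  by_contra! hx
  obtain ⟨a, b, c, d, e⟩ := x
  replace hx := List.eq_nil_iff_forall_not_mem.2 hx
  simp [lowerMoves] at hx
  simp_all

lemma mem_extensions {t : List Exponent} {m : Exponent} :
    m ∈ extensions t ↔ (m = (0, 0, 0, 0, 0) ∨ ∃ x ∈ t, m ∈ upperMoves x) ∧
      (∀ x ∈ t, x ≠ m ∧ exponentWeight x ≤ exponentWeight m) ∧ ∀ y ∈ lowerMoves m, y ∈ t := by
  simp only [extensions, List.mem_filter, List.mem_dedup, List.mem_cons, List.mem_flatMap,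
    Bool.and_eq_true, List.all_eq_true, decide_eq_true_eq]

lemma lowerLists_spec {n : ℕ} {l : List Exponent} (h : l ∈ lowerLists n) :
    l.length = n ∧ l.Nodup ∧ IsLowerExponents {x | x ∈ l} := by
  induction n generalizing l with
  | zero => simp_all [lowerLists, IsLowerExponents]
  | succ n ih =>
    simp only [lowerLists, List.mem_flatMap, List.mem_map] at h
    obtain ⟨t, ht, m, hm, rfl⟩ := h
    obtain ⟨hlen, hnd, hlow⟩ := ih ht
    obtain ⟨-, hmax, hcov⟩ := mem_extensions.1 hm
    refine ⟨by simp [hlen], List.nodup_cons.2 ⟨fun hmt => (hmax m hmt).1 rfl, hnd⟩, ?_⟩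
    intro x hx y hy
    rcases List.mem_cons.1 hx with rfl | hx
    · exact List.mem_cons_of_mem _ (hcov y hy)
    · exact List.mem_cons_of_mem _ (hlow x hx y hy)

lemma exists_mem_lowerLists {n : ℕ} {S : Finset Exponent} (hS : IsLowerExponents S)
    (hn : S.card = n) : ∃ l ∈ lowerLists n, ∀ x, x ∈ l ↔ x ∈ S := by
  induction n generalizing S with
  | zero => exact ⟨[], by simp [lowerLists], by simp [Finset.card_eq_zero.1 hn]⟩
  | succ n ih =>
    obtain ⟨m, hm, hmax⟩ := S.exists_max_image exponentWeight
      (Finset.card_pos.1 (by omega))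
    have hT : IsLowerExponents (S.erase m : Finset Exponent) := by
      intro x hx y hy
      simp only [Finset.coe_erase, Set.mem_sdiff, Finset.mem_coe, Set.mem_singleton_iff] at hx ⊢
      refine ⟨hS x hx.1 y hy, ?_⟩
      rintro rfl
      have := exponentWeight_lt_of_mem_lowerMoves hy
      have := hmax x hx.1
      omega
    obtain ⟨t, ht, htS⟩ := ih hT (by rw [Finset.card_erase_of_mem hm, hn]; rfl)
    have hcov : ∀ y ∈ lowerMoves m, y ∈ t := fun y hy => (htS y).2 <|
      Finset.mem_erase.2 ⟨fun h => (exponentWeight_lt_of_mem_lowerMoves hy).ne (by rw [h]),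
        hS m hm y hy⟩
    refine ⟨m :: t, ?_, ?_⟩
    · simp only [lowerLists, List.mem_flatMap, List.mem_map]
      refine ⟨t, ht, m, mem_extensions.2 ⟨?_, ?_, hcov⟩, rfl⟩
      · by_cases h0 : m = (0, 0, 0, 0, 0)
        · exact Or.inl h0
        · obtain ⟨y, hy⟩ := exists_mem_lowerMoves h0
          exact Or.inr ⟨y, hcov y hy, mem_upperMoves_of_mem_lowerMoves hy⟩
      · intro x hx
        have := Finset.mem_erase.1 ((htS x).1 hx)
        exact ⟨this.1, hmax x this.2⟩
    · intro x
      rw [List.mem_cons, htS, Finset.mem_erase]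
      by_cases h : x = m <;> simp [h, hm]

lemma length_lowerLists_twelve : (lowerLists 12).length = 92 := by decide +kernel

lemma nodup_lowerLists_twelve : (lowerLists 12).Nodup := by decide +kernel

lemma pairwise_of_mem_lowerLists_twelve :
    ∀ l ∈ lowerLists 12, l.Pairwise fun x y => exponentWeight y < exponentWeight x := by
  decide +kernel

lemma lowerLists_twelve_ext {l l' : List Exponent} (hl : l ∈ lowerLists 12)
    (hl' : l' ∈ lowerLists 12) (h : ∀ x, x ∈ l ↔ x ∈ l') : l = l' :=
  List.Perm.eq_of_pairwise (fun _ _ _ _ h₁ h₂ => absurd h₁ h₂.asymm)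
    (pairwise_of_mem_lowerLists_twelve l hl) (pairwise_of_mem_lowerLists_twelve l' hl')
    ((List.perm_ext_iff_of_nodup (lowerLists_spec hl).2.1 (lowerLists_spec hl').2.1).2 h)

/-- Finitely supported functions on `Fin 5` as tuples. -/
noncomputable def exponentEquiv : (Fin 5 →₀ ℕ) ≃ Exponent where
  toFun α := (α 0, α 1, α 2, α 3, α 4)
  invFun x := Finsupp.equivFunOnFinite.symm ![x.1, x.2.1, x.2.2.1, x.2.2.2.1, x.2.2.2.2]
  left_inv α := by
    ext i
    fin_cases i <;> rfl
  right_inv _ := rfl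

lemma exponentEquiv_apply (α : Fin 5 →₀ ℕ) :
    exponentEquiv α = (α 0, α 1, α 2, α 3, α 4) := rfl

lemma exponentEquiv_symm_add (a b c d e : ℕ) (β : Fin 5 →₀ ℕ) :
    exponentEquiv (exponentEquiv.symm (a, b, c, d, e) + β) =
      (a + β 0, b + β 1, c + β 2, d + β 3, e + β 4) := rfl

lemma isLowerExponents_iff {S : Set Exponent} :
    IsLowerExponents S ↔
      (∀ β, exponentEquiv (β + Finsupp.single 0 1) ∈ S → exponentEquiv β ∈ S) ∧
      ∀ (β : Fin 5 →₀ ℕ) (j : Fin 4), exponentEquiv (β + Finsupp.single j.succ 1) ∈ S →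
        exponentEquiv (β + Finsupp.single j.castSucc 1) ∈ S := by
  constructor
  · intro h
    refine ⟨fun β hβ => h _ hβ _ ?_, fun β j hβ => h _ hβ _ ?_⟩
    · simp [exponentEquiv_apply, lowerMoves]
    · fin_cases j <;> simp [exponentEquiv_apply, lowerMoves]
  · rintro ⟨h0, hs⟩ ⟨a, b, c, d, e⟩ hx y hy
    simp only [lowerMoves, List.mem_append] at hy
    rcases hy with (((h | h) | h) | h) | h <;> split_ifs at h with hne <;>
      simp only [List.not_mem_nil, List.mem_singleton] at h <;> subst h <;>
      obtain ⟨r, rfl⟩ := Nat.exists_eq_succ_of_ne_zero hne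
    · simpa using h0 (exponentEquiv.symm (r, b, c, d, e))
        (by simpa [exponentEquiv_symm_add, Finsupp.single_apply] using hx)
    · simpa [exponentEquiv_symm_add, Finsupp.single_apply] using hs (exponentEquiv.symm (a, r, c, d, e)) 0
        (by simpa [exponentEquiv_symm_add, Finsupp.single_apply] using hx)
    · simpa [exponentEquiv_symm_add, Finsupp.single_apply] using hs (exponentEquiv.symm (a, b, r, d, e)) 1
        (by simpa [exponentEquiv_symm_add, Finsupp.single_apply] using hx)
    · simpa [exponentEquiv_symm_add, Finsupp.single_apply] using hs (exponentEquiv.symm (a, b, c, r, e)) 2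
        (by simpa [exponentEquiv_symm_add, Finsupp.single_apply] using hx)
    · simpa [exponentEquiv_symm_add, Finsupp.single_apply] using hs (exponentEquiv.symm (a, b, c, d, r)) 3
        (by simpa [exponentEquiv_symm_add, Finsupp.single_apply] using hx)

lemma IsLowerExponents.move {S : Set Exponent} (hS : IsLowerExponents S) (β : Fin 5 →₀ ℕ)
    {i k : Fin 5} (hik : i ≤ k) (h : exponentEquiv (β + Finsupp.single k 1) ∈ S) :
    exponentEquiv (β + Finsupp.single i 1) ∈ S :=
  (Fin.antitone_iff_succ_le (f := fun k => exponentEquiv (β + Finsupp.single k 1) ∈ S)).2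
    (fun j => (isLowerExponents_iff.1 hS).2 β j) hik h

lemma IsLowerExponents.mem_of_le {S : Set Exponent} (hS : IsLowerExponents S)
    {α β : Fin 5 →₀ ℕ} (hβα : β ≤ α) (h : exponentEquiv α ∈ S) : exponentEquiv β ∈ S := by
  obtain ⟨γ, rfl⟩ := exists_add_of_le hβα
  clear hβα
  induction γ using Finsupp.induction_linear generalizing β with
  | zero => simpa using h
  | add f g hf hg => exact hf (hg (by rwa [add_assoc]))
  | single k n =>
    induction n with
    | zero => simpa using h
    | succ n ih =>
      rw [Finsupp.single_add, ← add_assoc] at h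
      exact ih ((isLowerExponents_iff.1 hS).1 _ (hS.move _ (Fin.zero_le k) h))

section MonomialIdeal

variable {σ K : Type*} [Field K]

/-- The monomial ideal spanned by the monomials with exponent outside `N`. -/
noncomputable def idealOfStandard (K : Type*) [Field K] (N : Set (σ →₀ ℕ)) :
    Ideal (MvPolynomial σ K) :=
  Ideal.span ((fun α => monomial α (1 : K)) '' Nᶜ)

lemma mem_idealOfStandard {N : Set (σ →₀ ℕ)} (hN : IsLowerSet N) {p : MvPolynomial σ K} :
    p ∈ idealOfStandard K N ↔ ∀ α ∈ p.support, α ∉ N := by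
  rw [idealOfStandard, mem_ideal_span_monomial_image]
  refine forall₂_congr fun α _ => ⟨?_, fun h => ⟨α, h, le_rfl⟩⟩
  rintro ⟨β, hβ, hle⟩ hα
  exact hβ (hN hle hα)

lemma monomial_mem_idealOfStandard {N : Set (σ →₀ ℕ)} (hN : IsLowerSet N) {α : σ →₀ ℕ} :
    monomial α (1 : K) ∈ idealOfStandard K N ↔ α ∉ N := by
  classical
  simp [mem_idealOfStandard hN, support_monomial]

lemma finrank_quotient_idealOfStandard {N : Set (σ →₀ ℕ)} (hN : IsLowerSet N) :
    Module.finrank K (MvPolynomial σ K ⧸ idealOfStandard K N) = N.ncard := by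
  classical
  let f : MvPolynomial σ K →ₗ[K] (N →₀ K) :=
    Finsupp.lsubtypeDomain N ∘ₗ (basisMonomials σ K).repr.toLinearMap
  have hf : Function.Surjective f :=
    Function.Surjective.comp (g := Finsupp.subtypeDomain (· ∈ N))
      (fun q => ⟨q.extendDomain, q.subtypeDomain_extendDomain⟩) (basisMonomials σ K).repr.surjective
  have hker : f.ker = (idealOfStandard K N).restrictScalars K := by
    ext p
    rw [LinearMap.mem_ker, Submodule.restrictScalars_mem, mem_idealOfStandard hN]
    simp only [mem_support_iff]
    constructor
    · intro h α hα hαN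
      exact hα (DFunLike.congr_fun h ⟨α, hαN⟩)
    · intro h
      ext ⟨α, hα⟩
      by_contra hne
      exact h α hne hα
  have e := (Submodule.Quotient.restrictScalarsEquiv K (idealOfStandard K N)).symm ≪≫ₗ
    Submodule.quotEquivOfEq _ _ hker.symm ≪≫ₗ f.quotKerEquivOfSurjective hf
  rw [Module.finrank_eq_nat_card_basis (Module.Basis.ofRepr e), Nat.card_coe_set_eq]

end MonomialIdeal

lemma IsMonomialIdeal.eq_idealOfStandard {n : ℕ} {K : Type} [Field K]
    {J : Ideal (MvPolynomial (Fin n) K)} (hJ : IsMonomialIdeal J) :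
    J = idealOfStandard K {α | monomial α (1 : K) ∉ J} := by
  obtain ⟨S, rfl⟩ := hJ
  apply le_antisymm
  · refine Ideal.span_mono (Set.image_mono fun α hα => ?_)
    simpa using Ideal.subset_span (Set.mem_image_of_mem _ hα)
  · rw [idealOfStandard, Ideal.span_le]
    rintro _ ⟨α, hα, rfl⟩
    simpa using hα

lemma isLowerSet_monomial_notMem {σ K : Type*} [Field K] (J : Ideal (MvPolynomial σ K)) :
    IsLowerSet {α | monomial α (1 : K) ∉ J} := by
  intro α β hβα hα hβ
  obtain ⟨γ, rfl⟩ := exists_add_of_le hβα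
  refine hα ?_
  rw [← one_mul (1 : K), ← monomial_mul]
  exact J.mul_mem_right _ hβ

lemma StronglyStable.isLowerExponents {K : Type} [Field K] {J : Ideal (MvPolynomial (Fin 5) K)}
    (hJ : StronglyStable J) :
    IsLowerExponents (exponentEquiv '' {α | monomial α (1 : K) ∉ J}) := by
  simp only [isLowerExponents_iff, exponentEquiv.injective.mem_set_image, Set.mem_ofPred_eq]
  refine ⟨fun β h => isLowerSet_monomial_notMem J le_self_add h, fun β j h hj => h ?_⟩
  simpa using hJ _ hj j.castSucc j.succ Fin.castSucc_lt_succ (by simp)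

lemma IsLowerExponents.stronglyStable {K : Type} [Field K] {S : Set Exponent}
    (hS : IsLowerExponents S) : StronglyStable (idealOfStandard K (exponentEquiv ⁻¹' S)) := by
  have hlow : IsLowerSet (exponentEquiv ⁻¹' S) := fun _ _ => hS.mem_of_le
  intro α hα i k hik hi
  rw [monomial_mem_idealOfStandard hlow] at hα ⊢
  intro h
  have := hS.move _ hik.le h
  rw [tsub_add_cancel_of_le (by simpa [Nat.one_le_iff_ne_zero] using hi)] at this
  exact hα this

/-- There are exactly `92` strongly stable monomial ideals `J ⊆ K[x₁,…,x₅]` with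
`dim_K K[x₁,…,x₅]/J = 12`. -/
theorem card_stronglyStable_colength12 (K : Type) [Field K] :
    {J : Ideal (MvPolynomial (Fin 5) K) |
      IsMonomialIdeal J ∧ StronglyStable J ∧
      Module.finrank K (MvPolynomial (Fin 5) K ⧸ J) = 12}.ncard = 92 := by
  classical
  have hlow {l : List Exponent} (hl : l ∈ lowerLists 12) :
      IsLowerSet (exponentEquiv ⁻¹' {x | x ∈ l}) :=
    fun _ _ => (lowerLists_spec hl).2.2.mem_of_le
  have himage : {J : Ideal (MvPolynomial (Fin 5) K) |
      IsMonomialIdeal J ∧ StronglyStable J ∧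
      Module.finrank K (MvPolynomial (Fin 5) K ⧸ J) = 12} =
      (fun l => idealOfStandard K (exponentEquiv ⁻¹' {x | x ∈ l})) ''
        ((lowerLists 12).toFinset : Set (List Exponent)) := by
    ext J
    simp only [Set.mem_ofPred_eq, Set.mem_image, Finset.mem_coe, List.mem_toFinset]
    constructor
    · rintro ⟨hmon, hst, hrank⟩
      set N := {α | monomial α (1 : K) ∉ J} with hN
      have hJ : J = idealOfStandard K N := hmon.eq_idealOfStandard
      have hcard : N.ncard = 12 := by
        rwa [hJ, finrank_quotient_idealOfStandard (isLowerSet_monomial_notMem J)] at hrank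
      have hfin : N.Finite := Set.finite_of_ncard_ne_zero (by omega)
      have hS : IsLowerExponents ((hfin.image exponentEquiv).toFinset : Set Exponent) := by
        simpa using hst.isLowerExponents
      obtain ⟨l, hl, hlS⟩ := exists_mem_lowerLists hS (n := 12) (by
        rw [← Set.ncard_eq_toFinset_card _ (hfin.image exponentEquiv), Set.ncard_image_of_injective _ exponentEquiv.injective,
          hcard])
      refine ⟨l, hl, ?_⟩
      rw [hJ]
      congr 1
      ext α
      simp only [Set.mem_preimage, Set.mem_ofPred_eq, hlS, Set.Finite.mem_toFinset,
        exponentEquiv.injective.mem_set_image]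
    · rintro ⟨l, hl, rfl⟩
      obtain ⟨hlen, hnd, hS⟩ := lowerLists_spec hl
      refine ⟨⟨_, rfl⟩, hS.stronglyStable, ?_⟩
      rw [finrank_quotient_idealOfStandard (hlow hl), ← List.coe_toFinset,
        Set.ncard_preimage_of_injective_subset_range exponentEquiv.injective (by simp),
        Set.ncard_coe_finset, List.toFinset_card_of_nodup hnd, hlen]
  rw [himage, Set.InjOn.ncard_image, Set.ncard_coe_finset,
    List.toFinset_card_of_nodup nodup_lowerLists_twelve, length_lowerLists_twelve]
  intro l hl l' hl' h
  simp only [Finset.mem_coe, List.mem_toFinset] at hl hl' h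
  refine lowerLists_twelve_ext hl hl' fun x => ?_
  have hx := monomial_mem_idealOfStandard (K := K) (hlow hl) (α := exponentEquiv.symm x)
  rw [h, monomial_mem_idealOfStandard (hlow hl')] at hx
  simpa [not_iff_not] using hx.symm
end

section
/- Let K be a field of characteristic 0, R = K[x1,…,x7], and let 𝔞 ⊆ R be the ideal generated by the 32 polynomials listed in the context. Then: (i) the residue classes of the 16 monomials 1, x1, x2, x3, x4, x5, x6, x7, x1², x1x2, x1x3, x1x4, x2², x2x3, x3², x1³ form a K-basis of R/𝔞 (in particular dim_K R/𝔞 = 16); and (ii) the K-vector space of R-module homomorphisms Hom_R(𝔞, R/𝔞) has dimension 161 over K. -/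
set_option maxHeartbeats 4000000
set_option maxRecDepth 4000

open MvPolynomial

/-- The 32 generators of the ideal `𝔞 ⊆ K[x₁,…,x₇]` (here `x_i` is `X (i-1)`). -/
noncomputable def aGens (K : Type) [Field K] : Set (MvPolynomial (Fin 7) K) :=
  {    X 6 ^ 2 - (-3 * X 0 ^ 3 + 126 * X 0 ^ 2 - 3 * (X 0 * X 1) - 2 * (X 0 * X 2)
      + X 0 * X 3 - 3 * (X 1 * X 2) + 2 * X 2 ^ 2),
    X 5 * X 6 - (-(X 0 ^ 3) + 270 * X 0 ^ 2 - 3 * (X 0 * X 1) - 3 * (X 0 * X 2)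
      - X 0 * X 3 - 2 * X 1 ^ 2 - X 1 * X 2 - X 2 ^ 2),
    X 4 * X 6 - (-209 * X 0 ^ 2 + X 0 * X 1 - 2 * (X 0 * X 2) - X 0 * X 3
      - 2 * X 1 ^ 2 - X 1 * X 2 - 2 * X 2 ^ 2),
    X 3 * X 6 - (X 0 ^ 3 - 60 * X 0 ^ 2 - 3 * (X 0 * X 1) - X 0 * X 2 - X 0 * X 3
      + X 1 ^ 2 - 2 * (X 1 * X 2) - X 2 ^ 2),
    X 2 * X 6 - (-2 * X 0 ^ 3 + 28 * X 0 ^ 2 - X 0 * X 1 + X 0 * X 2 - 2 * X 1 ^ 2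
      + 2 * (X 1 * X 2) + 2 * X 2 ^ 2),
    X 1 * X 6 - (-(X 0 ^ 3) - 67 * X 0 ^ 2 - 2 * (X 0 * X 1) - 3 * (X 0 * X 2)
      - 2 * (X 0 * X 3) + 2 * X 1 ^ 2 - 2 * (X 1 * X 2) - 3 * X 2 ^ 2),
    X 0 * X 6 - (-2 * X 0 ^ 3 + X 0 ^ 2 - 2 * (X 0 * X 1) + X 0 * X 2 - X 0 * X 3
      - X 2 ^ 2),
    X 5 ^ 2 - (X 0 ^ 3 + 469 * X 0 ^ 2 - 2 * (X 0 * X 1) - X 0 * X 2 - 3 * (X 0 * X 3)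
      + 2 * X 2 ^ 2),
    X 4 * X 5 - (X 0 ^ 3 - 412 * X 0 ^ 2 - 2 * (X 0 * X 2) - 3 * X 2 ^ 2),
    X 3 * X 5 - (-61 * X 0 ^ 2 + 2 * (X 0 * X 1) - 3 * (X 0 * X 2) - 3 * (X 0 * X 3)
      - X 1 ^ 2 - 2 * (X 1 * X 2) - 2 * X 2 ^ 2),
    X 2 * X 5 - (2 * X 0 ^ 3 + 29 * X 0 ^ 2 + X 0 * X 1 - 2 * (X 0 * X 2) - X 0 * X 3
      - 3 * X 2 ^ 2),
    X 1 * X 5 - (-(X 0 ^ 3) - 61 * X 0 ^ 2 - 2 * (X 0 * X 1) + X 0 * X 2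
      + 2 * (X 0 * X 3) - 2 * X 1 ^ 2 - 3 * (X 1 * X 2) + 2 * X 2 ^ 2),
    X 0 * X 5 - (X 0 ^ 3 + 2 * X 0 ^ 2 - X 0 * X 1 + 2 * X 1 ^ 2),
    X 4 ^ 2 - (2 * X 0 ^ 3 + 342 * X 0 ^ 2 - 2 * (X 0 * X 1) - X 0 * X 2 + X 1 ^ 2
      - 3 * (X 1 * X 2) - 2 * X 2 ^ 2),
    X 3 * X 4 - (X 0 ^ 3 + 55 * X 0 ^ 2 - 2 * (X 0 * X 1) - 2 * (X 0 * X 2)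
      - 3 * (X 0 * X 3) - X 1 ^ 2 - X 2 ^ 2),
    X 2 * X 4 - (-2 * X 0 ^ 3 - 23 * X 0 ^ 2 - 3 * (X 0 * X 1) - 3 * (X 0 * X 2)
      - 3 * (X 0 * X 3) - 2 * X 1 ^ 2 - X 1 * X 2 + 2 * X 2 ^ 2),
    X 1 * X 4 - (-(X 0 ^ 3) + 69 * X 0 ^ 2 - X 0 * X 1 - 2 * (X 0 * X 2)
      - 3 * (X 0 * X 3) - 3 * X 1 ^ 2 - 2 * (X 1 * X 2) - 2 * X 2 ^ 2),
    X 0 * X 4 - (-3 * X 0 ^ 3 + X 0 ^ 2 - 2 * (X 0 * X 1) + X 0 * X 2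
      - 2 * (X 0 * X 3) - 3 * X 1 ^ 2 + 2 * (X 1 * X 2) - 3 * X 2 ^ 2),
    X 3 ^ 2 - (10 * X 0 ^ 2 + 2 * (X 0 * X 1) - 3 * (X 0 * X 2) - 3 * (X 1 * X 2)
      - X 2 ^ 2),
    X 2 * X 3 - (X 0 ^ 3 + 19 * X 0 ^ 2 + 2 * (X 0 * X 1) + 2 * (X 0 * X 3)
      - 2 * X 1 ^ 2 - 3 * (X 1 * X 2)),
    X 1 * X 3 - (X 0 ^ 3 + 13 * X 0 ^ 2 - X 0 * X 1 + 2 * (X 1 * X 2)),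
    X 0 ^ 2 * X 3 + 3 * X 0 ^ 3,
    X 2 ^ 3 - X 0 ^ 3,
    X 1 * X 2 ^ 2 + 3 * X 0 ^ 3,
    X 0 * X 2 ^ 2 - X 0 ^ 3,
    X 1 ^ 2 * X 2 - 9 * X 0 ^ 3,
    X 0 * X 1 * X 2 + 3 * X 0 ^ 3,
    X 0 ^ 2 * X 2 - X 0 ^ 3,
    X 1 ^ 3 + 27 * X 0 ^ 3,
    X 0 * X 1 ^ 2 - 9 * X 0 ^ 3,
    X 0 ^ 2 * X 1 + 3 * X 0 ^ 3,
    X 0 ^ 4 + X 0 ^ 3 }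

/-- The 16 monomials `1, x₁,…,x₇, x₁², x₁x₂, x₁x₃, x₁x₄, x₂², x₂x₃, x₃², x₁³`. -/
noncomputable def mons16 (K : Type) [Field K] : Fin 16 → MvPolynomial (Fin 7) K :=
  ![1, X 0, X 1, X 2, X 3, X 4, X 5, X 6, X 0 ^ 2, X 0 * X 1, X 0 * X 2, X 0 * X 3,
    X 1 ^ 2, X 1 * X 2, X 2 ^ 2, X 0 ^ 3]

/-- The structure constants of the local algebra: `xᵢ xⱼ = ∑ₗ mulCoeff i j l • mₗ`, where
`m₀, …, m₆` are the quadratic monomials indexed by `stdPair`. -/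
def mulCoeff : Fin 7 → Fin 7 → Fin 7 → ℤ :=
  ![![![1, 0, 0, 0, 0, 0, 0],
      ![0, 1, 0, 0, 0, 0, 0],
      ![0, 0, 1, 0, 0, 0, 0],
      ![0, 0, 0, 1, 0, 0, 0],
      ![1, -2, 1, -2, -3, 2, -3],
      ![2, -1, 0, 0, 2, 0, 0],
      ![1, -2, 1, -1, 0, 0, -1]],
    ![![0, 1, 0, 0, 0, 0, 0],
      ![0, 0, 0, 0, 1, 0, 0],
      ![0, 0, 0, 0, 0, 1, 0],
      ![13, -1, 0, 0, 0, 2, 0],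
      ![69, -1, -2, -3, -3, -2, -2],
      ![-61, -2, 1, 2, -2, -3, 2],
      ![-67, -2, -3, -2, 2, -2, -3]],
    ![![0, 0, 1, 0, 0, 0, 0],
      ![0, 0, 0, 0, 0, 1, 0],
      ![0, 0, 0, 0, 0, 0, 1],
      ![19, 2, 0, 2, -2, -3, 0],
      ![-23, -3, -3, -3, -2, -1, 2],
      ![29, 1, -2, -1, 0, 0, -3],
      ![28, -1, 1, 0, -2, 2, 2]],
    ![![0, 0, 0, 1, 0, 0, 0],
      ![13, -1, 0, 0, 0, 2, 0],
      ![19, 2, 0, 2, -2, -3, 0],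
      ![10, 2, -3, 0, 0, -3, -1],
      ![55, -2, -2, -3, -1, 0, -1],
      ![-61, 2, -3, -3, -1, -2, -2],
      ![-60, -3, -1, -1, 1, -2, -1]],
    ![![1, -2, 1, -2, -3, 2, -3],
      ![69, -1, -2, -3, -3, -2, -2],
      ![-23, -3, -3, -3, -2, -1, 2],
      ![55, -2, -2, -3, -1, 0, -1],
      ![342, -2, -1, 0, 1, -3, -2],
      ![-412, 0, -2, 0, 0, 0, -3],
      ![-209, 1, -2, -1, -2, -1, -2]],
    ![![2, -1, 0, 0, 2, 0, 0],
      ![-61, -2, 1, 2, -2, -3, 2],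
      ![29, 1, -2, -1, 0, 0, -3],
      ![-61, 2, -3, -3, -1, -2, -2],
      ![-412, 0, -2, 0, 0, 0, -3],
      ![469, -2, -1, -3, 0, 0, 2],
      ![270, -3, -3, -1, -2, -1, -1]],
    ![![1, -2, 1, -1, 0, 0, -1],
      ![-67, -2, -3, -2, 2, -2, -3],
      ![28, -1, 1, 0, -2, 2, 2],
      ![-60, -3, -1, -1, 1, -2, -1],
      ![-209, 1, -2, -1, -2, -1, -2],
      ![270, -3, -3, -1, -2, -1, -1],
      ![126, -3, -2, 1, 0, -3, 2]]]

/-- The quadratic monomials surviving in the quotient. -/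
def stdPair : Fin 7 → Fin 7 × Fin 7 :=
  ![(0, 0), (0, 1), (0, 2), (0, 3), (1, 1), (1, 2), (2, 2)]

/-- The quadratic monomials rewritten in terms of the standard ones. -/
def leadPair : Fin 21 → Fin 7 × Fin 7 :=
  ![(0, 4), (0, 5), (0, 6), (1, 3), (1, 4), (1, 5), (1, 6), (2, 3), (2, 4), (2, 5), (2, 6),
    (3, 3), (3, 4), (3, 5), (3, 6), (4, 4), (4, 5), (4, 6), (5, 5), (5, 6), (6, 6)]

/-! ### Gaussian elimination modulo two -/

/-- The members of a list that are at least `t`. -/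
def filterGE (t : ℕ) (rows : List ℕ) : List ℕ :=
  rows.foldr (fun r l => bif Nat.ble t r then r :: l else l) []

/-- Eliminates the unknowns `b - 1, …, 0` from a homogeneous system over `𝔽₂` whose equations are
given as bit masks; returns `true` if every unknown gets a pivot. -/
def elimMod2 : ℕ → List ℕ → Bool
  | 0, _ => true
  | b + 1, rows =>
    match filterGE (Nat.pow 2 b) rows with
    | [] => false
    | p :: _ => elimMod2 b (rows.foldr
        (fun r l => bif Nat.ble (Nat.pow 2 b) r then
          (bif Nat.beq r p then l else Nat.xor r p :: l) else r :: l) [])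

/-- The bit mask of the reduction modulo two of a linear form given by coefficient-index pairs. -/
def maskMod2 (row : List (ℤ × ℕ)) : ℕ :=
  row.foldr (fun t m => bif Nat.beq (t.1.natAbs % 2) 1 then Nat.xor m (2 ^ t.2) else m) 0

/-- Position of a cubic monomial in the list of all cubic monomials in seven variables. -/
def cubicIndex (i j k : Fin 7) : ℕ :=
  let a := min i.val (min j.val k.val)
  let c := max i.val (max j.val k.val)
  let b := i.val + j.val + k.val - a - c
  c * (c + 1) * (c + 2) / 6 + b * (b + 1) / 2 + a

def valueIndex (j : Fin 21) (l : Fin 7) : ℕ := j.val * 7 + l.val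

def cubicValueIndex (c : Fin 3) (i j k : Fin 7) : ℕ := 147 + c.val * 84 + cubicIndex i j k

def syzygyRow (γ : Fin 7 → Fin 7 → Fin 3 → ℤ) (c : Fin 3) (k : Fin 7) (j : Fin 21) :
    List (ℤ × ℕ) :=
  (1, cubicValueIndex c k (leadPair j).1 (leadPair j).2) ::
    ((List.finRange 7).map (fun l =>
      (-mulCoeff (leadPair j).1 (leadPair j).2 l,
        cubicValueIndex c k (stdPair l).1 (stdPair l).2)) ++
    (List.finRange 7).map (fun l => (-γ k l c, valueIndex j l)))

def syzygySystem (γ : Fin 7 → Fin 7 → Fin 3 → ℤ) (norm : List (Fin 21 × Fin 7)) :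
    List (List (ℤ × ℕ)) :=
  norm.map (fun t => [(1, valueIndex t.1 t.2)]) ++
  (List.finRange 3).flatMap (fun c => (List.finRange 7).flatMap (fun k =>
    (List.finRange 21).map (fun j => syzygyRow γ c k j)))

/-- Certifies that a system in `n` unknowns is nondegenerate modulo two. -/
def certMod2 (n : ℕ) (rows : List (List (ℤ × ℕ))) : Bool :=
  rows.all (fun row => row.all fun t => Nat.blt t.2 n) && elimMod2 n (rows.map maskMod2)

def coeffDegOne : Fin 7 → Fin 7 → Fin 3 → ℤ := fun k l c => mulCoeff k l (c.castLE (by decide))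

def coeffDegTwo : Fin 7 → Fin 7 → Fin 3 → ℤ := fun k l c => if l = 0 ∧ k.val = c.val then 1 else 0

/-- The coordinates used to normalise a homomorphism by derivations. -/
def normPair : Fin 7 → Fin 21 × Fin 7 :=
  ![(2, 6), (6, 6), (10, 6), (14, 6), (17, 6), (19, 6), (17, 4)]

/-- The linear form over `𝔽₂` encoded by a bit mask. -/
def maskEval (n : ℕ) (u : ℕ → ZMod 2) (r : ℕ) : ZMod 2 :=
  ∑ i ∈ Finset.range n, if r.testBit i then u i else 0

theorem maskEval_xor (n : ℕ) (u : ℕ → ZMod 2) (r s : ℕ) :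
    maskEval n u (r ^^^ s) = maskEval n u r + maskEval n u s := by
  simp only [maskEval, ← Finset.sum_add_distrib, Nat.testBit_xor]
  refine Finset.sum_congr rfl fun i _ => ?_
  cases r.testBit i <;> cases s.testBit i <;> simp [CharTwo.add_self_eq_zero]

theorem maskEval_zero (n : ℕ) (u : ℕ → ZMod 2) : maskEval n u 0 = 0 := by
  simp [maskEval]

theorem maskEval_two_pow {n i : ℕ} (hi : i < n) (u : ℕ → ZMod 2) :
    maskEval n u (2 ^ i) = u i := by
  rw [maskEval, Finset.sum_eq_single i]
  · simp [Nat.testBit_two_pow_self]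
  · intro j _ hj
    simp [Nat.testBit_two_pow_of_ne hj.symm]
  · simp [hi]

theorem xor_lt_two_pow {b r p : ℕ} (hr : 2 ^ b ≤ r) (hr' : r < 2 ^ (b + 1)) (hp : 2 ^ b ≤ p)
    (hp' : p < 2 ^ (b + 1)) : r ^^^ p < 2 ^ b := by
  refine Nat.lt_pow_two_of_testBit _ fun i hi => ?_
  rcases hi.eq_or_lt with rfl | hi
  · rw [Nat.testBit_xor, Nat.testBit_of_two_pow_le_and_two_pow_add_one_gt hr hr',
      Nat.testBit_of_two_pow_le_and_two_pow_add_one_gt hp hp']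
    rfl
  · exact Nat.testBit_lt_two_pow (lt_of_lt_of_le (Nat.xor_lt_two_pow hr' hp')
      (Nat.pow_le_pow_right two_pos hi))

theorem mem_of_mem_filterGE {t r : ℕ} {rows : List ℕ} (h : r ∈ filterGE t rows) :
    r ∈ rows ∧ t ≤ r := by
  induction rows with
  | nil => simp [filterGE] at h
  | cons a l ih =>
    by_cases ha : t ≤ a
    · have : filterGE t (a :: l) = a :: filterGE t l := by
        simp [filterGE, Nat.ble_eq_true_of_le ha]
      rw [this, List.mem_cons] at h
      rcases h with rfl | h
      · exact ⟨List.mem_cons_self, ha⟩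
      · exact ⟨List.mem_cons_of_mem _ (ih h).1, (ih h).2⟩
    · have : filterGE t (a :: l) = filterGE t l := by
        simp only [filterGE, List.foldr_cons]
        rw [show Nat.ble t a = false from
          Bool.eq_false_iff.mpr fun h => ha (Nat.le_of_ble_eq_true h)]
        rfl
      rw [this] at h
      exact ⟨List.mem_cons_of_mem _ (ih h).1, (ih h).2⟩

theorem eq_zero_of_elimMod2 (u : ℕ → ZMod 2) (b : ℕ) (rows : List ℕ)
    (h : elimMod2 b rows = true) (hlt : ∀ r ∈ rows, r < 2 ^ b)
    (h0 : ∀ r ∈ rows, maskEval b u r = 0) : ∀ i < b, u i = 0 := by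
  induction b generalizing rows with
  | zero => simp
  | succ b ih =>
    rw [elimMod2] at h
    have hp := fun p => @mem_of_mem_filterGE (Nat.pow 2 b) p rows
    generalize filterGE (Nat.pow 2 b) rows = G at h hp
    match G, h, hp with
    | p :: tl, h, hp =>
      obtain ⟨hpm, hpge⟩ := hp p List.mem_cons_self
      have hpge : 2 ^ b ≤ p := hpge
      have hplt := hlt p hpm
      have hmem : ∀ (l : List ℕ), (∀ r ∈ l, r ∈ rows) → ∀ s ∈ l.foldr
          (fun r l => bif Nat.ble (Nat.pow 2 b) r then
            (bif Nat.beq r p then l else Nat.xor r p :: l) else r :: l) [],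
          s < 2 ^ b ∧ maskEval (b + 1) u s = 0 := by
        intro l
        induction l with
        | nil => simp
        | cons a l ihl =>
          intro hl s hs
          have ha := hl a List.mem_cons_self
          have ihl := ihl fun r hr => hl r (List.mem_cons_of_mem _ hr)
          rw [List.foldr_cons] at hs
          by_cases hab : 2 ^ b ≤ a
          · rw [show Nat.ble (Nat.pow 2 b) a = true from Nat.ble_eq_true_of_le hab, cond_true] at hs
            cases hap : Nat.beq a p with
            | true => rw [hap, cond_true] at hs; exact ihl s hs
            | false =>
              rw [hap, cond_false, List.mem_cons] at hs
              rcases hs with rfl | hs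
              · refine ⟨xor_lt_two_pow hab (hlt a ha) hpge hplt, ?_⟩
                exact (maskEval_xor _ _ _ _).trans (by rw [h0 a ha, h0 p hpm, add_zero])
              · exact ihl s hs
          · rw [show Nat.ble (Nat.pow 2 b) a = false from
              Bool.eq_false_iff.mpr fun h => hab (Nat.le_of_ble_eq_true h), cond_false,
              List.mem_cons] at hs
            rcases hs with rfl | hs
            · exact ⟨not_le.mp hab, h0 s ha⟩
            · exact ihl s hs
      have hrec := hmem rows fun _ hr => hr
      have hlow : ∀ i < b, u i = 0 := ih _ h (fun r hr => (hrec r hr).1) fun r hr => by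
        have h1 := (hrec r hr).2
        rw [maskEval, Finset.sum_range_succ, Nat.testBit_lt_two_pow (hrec r hr).1] at h1
        simpa [maskEval] using h1
      have hb : u b = 0 := by
        have h1 := h0 p hpm
        rw [maskEval, Finset.sum_range_succ,
          Nat.testBit_of_two_pow_le_and_two_pow_add_one_gt hpge hplt, Finset.sum_eq_zero] at h1
        · simpa using h1
        · intro i hi
          rw [hlow i (Finset.mem_range.mp hi), ite_self]
      intro i hi
      rcases Nat.lt_succ_iff_lt_or_eq.mp hi with hi | rfl
      · exact hlow i hi
      · exact hb

/-- The value of a linear form given by coefficient-index pairs. -/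
def rowEval {F : Type*} [Ring F] (u : ℕ → F) (row : List (ℤ × ℕ)) : F :=
  (row.map fun t => (t.1 : F) * u t.2).sum

theorem maskMod2_spec {n : ℕ} (u : ℕ → ZMod 2) (row : List (ℤ × ℕ)) (h : ∀ t ∈ row, t.2 < n) :
    maskMod2 row < 2 ^ n ∧ maskEval n u (maskMod2 row) = rowEval u row := by
  induction row with
  | nil => simp [maskMod2, rowEval, maskEval_zero]
  | cons a l ih =>
    obtain ⟨h1, h2⟩ := ih fun t ht => h t (List.mem_cons_of_mem _ ht)
    have ha := h a List.mem_cons_self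
    have hr : rowEval u (a :: l) = a.1 * u a.2 + rowEval u l := by simp [rowEval]
    rw [hr]
    rcases Nat.mod_two_eq_zero_or_one a.1.natAbs with h0 | h0
    · have : maskMod2 (a :: l) = maskMod2 l := by
        simp [maskMod2, h0, show Nat.beq 0 1 = false from rfl]
      have hz : (a.1 : ZMod 2) = 0 := by
        rw [ZMod.intCast_zmod_eq_zero_iff_dvd]
        omega
      rw [this, hz, h2]
      exact ⟨h1, by ring⟩
    · have : maskMod2 (a :: l) = maskMod2 l ^^^ 2 ^ a.2 := by simp [maskMod2, h0]
      have hz : (a.1 : ZMod 2) = 1 := by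
        have : (a.1 : ZMod 2) = ((1 : ℤ) : ZMod 2) := by
          rw [ZMod.intCast_eq_intCast_iff_dvd_sub]
          omega
        simpa using this
      rw [this, hz, maskEval_xor, maskEval_two_pow ha, h2]
      exact ⟨Nat.xor_lt_two_pow h1 (Nat.pow_lt_pow_right one_lt_two ha), by ring⟩

/-- An integral linear system without nonzero solutions modulo a prime has no nonzero solutions in
characteristic zero. -/
theorem mulVec_eq_zero_of_mod_prime {m n : ℕ} (p : ℕ) [Fact p.Prime]
    (M : Matrix (Fin m) (Fin n) ℤ)
    (h : ∀ u : Fin n → ZMod p, (M.map (Int.cast : ℤ → ZMod p)).mulVec u = 0 → u = 0)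
    {K : Type*} [Field K] [CharZero K] (u : Fin n → K)
    (hu : (M.map (Int.cast : ℤ → K)).mulVec u = 0) : u = 0 := by
  obtain ⟨g, hg⟩ := LinearMap.exists_leftInverse_of_injective
    (Matrix.toLin' (M.map (Int.cast : ℤ → ZMod p)))
    (LinearMap.ker_eq_bot'.mpr fun u hu => h u (by simpa using hu))
  have hL : LinearMap.toMatrix' g * M.map (Int.cast : ℤ → ZMod p) = 1 := by
    rw [← LinearMap.toMatrix'_toLin' (M.map (Int.cast : ℤ → ZMod p)), ← LinearMap.toMatrix'_comp,
      hg, LinearMap.toMatrix'_id]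
  obtain ⟨L, hL'⟩ : ∃ L : Matrix (Fin n) (Fin m) ℤ,
      L.map (Int.cast : ℤ → ZMod p) = LinearMap.toMatrix' g :=
    ⟨fun i j => (ZMod.intCast_surjective (LinearMap.toMatrix' g i j)).choose,
      Matrix.ext fun i j => (ZMod.intCast_surjective (LinearMap.toMatrix' g i j)).choose_spec⟩
  have hdet : (L * M).det ≠ 0 := by
    intro h0
    have h1 := congrArg (Int.castRingHom (ZMod p)) h0
    rw [RingHom.map_det, RingHom.mapMatrix_apply, Matrix.map_mul, map_zero] at h1
    have h2 : L.map (Int.castRingHom (ZMod p)) * M.map (Int.castRingHom (ZMod p)) = 1 := by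
      rw [← hL, ← hL']
      rfl
    rw [h2, Matrix.det_one] at h1
    exact one_ne_zero h1
  have hdetK : ((L * M).map (Int.castRingHom K)).det ≠ 0 := by
    rw [← RingHom.mapMatrix_apply, ← RingHom.map_det]
    simpa using hdet
  refine Matrix.eq_zero_of_mulVec_eq_zero hdetK ?_
  rw [Matrix.map_mul, ← Matrix.mulVec_mulVec]
  have : (M.map (Int.castRingHom K)).mulVec u = 0 := hu
  rw [this, Matrix.mulVec_zero]

/-- The coefficient matrix of a system given by coefficient-index pairs. -/
def systemMatrix (n : ℕ) (rows : List (List (ℤ × ℕ))) : Matrix (Fin rows.length) (Fin n) ℤ :=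
  Matrix.of fun r i => (rows[r].map fun t => if t.2 = i.val then t.1 else 0).sum

theorem systemMatrix_mulVec {n : ℕ} {rows : List (List (ℤ × ℕ))}
    (hidx : ∀ row ∈ rows, ∀ t ∈ row, t.2 < n) {F : Type*} [Field F] (w : ℕ → F)
    (r : Fin rows.length) :
    ((systemMatrix n rows).map (Int.cast : ℤ → F)).mulVec (fun i => w i) r =
      rowEval w rows[r] := by
  have hr := hidx rows[r] (List.getElem_mem _)
  simp only [Matrix.mulVec, dotProduct, systemMatrix, rowEval, Matrix.map_apply, Matrix.of_apply]
  generalize rows[r] = row at hr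
  induction row with
  | nil => simp
  | cons a l ih =>
    have ih := ih fun t ht => hr t (List.mem_cons_of_mem _ ht)
    have ha := hr a List.mem_cons_self
    simp only [List.map_cons, List.sum_cons, Int.cast_add, add_mul, Finset.sum_add_distrib, ih]
    congr 1
    rw [Finset.sum_eq_single (⟨a.2, ha⟩ : Fin n)]
    · simp
    · intro j _ hj
      rw [if_neg fun h => hj (Fin.ext h.symm), Int.cast_zero, zero_mul]
    · simp

theorem eq_zero_of_certMod2 {n : ℕ} {rows : List (List (ℤ × ℕ))} (h : certMod2 n rows = true)
    {K : Type*} [Field K] [CharZero K] (u : ℕ → K) (hu : ∀ row ∈ rows, rowEval u row = 0) :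
    ∀ i < n, u i = 0 := by
  rw [certMod2, Bool.and_eq_true, List.all_eq_true] at h
  obtain ⟨hidx, helim⟩ := h
  replace hidx : ∀ row ∈ rows, ∀ t ∈ row, t.2 < n := fun row hrow t ht => by
    have h1 := List.all_eq_true.mp (hidx row hrow) t ht
    exact Nat.le_of_ble_eq_true h1
  set M := systemMatrix n rows
  have hmod : ∀ w : Fin n → ZMod 2, (M.map (Int.cast : ℤ → ZMod 2)).mulVec w = 0 → w = 0 := by
    intro w hw
    let w' : ℕ → ZMod 2 := fun i => if hi : i < n then w ⟨i, hi⟩ else 0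
    have hw' : (fun i : Fin n => w' i) = w := funext fun i => by simp [w']
    have h0 := eq_zero_of_elimMod2 w' n (rows.map maskMod2) helim
      (by
        intro r hr
        obtain ⟨row, hrow, rfl⟩ := List.mem_map.mp hr
        exact (maskMod2_spec w' row (hidx row hrow)).1)
      (by
        intro r hr
        obtain ⟨row, hrow, rfl⟩ := List.mem_map.mp hr
        rw [(maskMod2_spec w' row (hidx row hrow)).2]
        obtain ⟨k, hk, rfl⟩ := List.getElem_of_mem hrow
        have h1 := systemMatrix_mulVec hidx w' ⟨k, hk⟩
        rw [hw', hw] at h1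
        exact h1.symm)
    funext i
    have h1 := h0 i i.2
    simpa [w'] using h1
  have := mulVec_eq_zero_of_mod_prime 2 M hmod (fun i => u i) (by
    funext r
    rw [systemMatrix_mulVec hidx u r]
    exact hu _ (List.getElem_mem _))
  intro i hi
  exact congrFun this ⟨i, hi⟩

/-- All cubic monomials in seven variables, as nondecreasing index triples. -/
def cubicTriples : List (Fin 7 × Fin 7 × Fin 7) :=
  (List.range 7).flatMap fun c => (List.range (c + 1)).flatMap fun b =>
    (List.range (b + 1)).map fun a => (Fin.ofNat 7 a, Fin.ofNat 7 b, Fin.ofNat 7 c)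

theorem cubicTriples_getD_cubicIndex : ∀ i j k : Fin 7,
    cubicIndex i j k < 84 ∧
    cubicTriples.getD (cubicIndex i j k) (0, 0, 0) ∈
      [(i, j, k), (i, k, j), (j, i, k), (j, k, i), (k, i, j), (k, j, i)] := by
  decide +kernel

/-- The assignment of values to the unknowns of `syzygySystem`. -/
def unknowns {K : Type*} (v : Fin 21 → Fin 7 → K) (τ : Fin 3 → Fin 7 → Fin 7 → Fin 7 → K)
    (n : ℕ) : K :=
  if n < 147 then v (Fin.ofNat 21 (n / 7)) (Fin.ofNat 7 (n % 7)) else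
    let t := cubicTriples.getD ((n - 147) % 84) (0, 0, 0)
    τ (Fin.ofNat 3 ((n - 147) / 84)) t.1 t.2.1 t.2.2

theorem valueIndex_lt (j : Fin 21) (l : Fin 7) : valueIndex j l < 147 := by
  unfold valueIndex
  omega

theorem cubicValueIndex_lt (c : Fin 3) (i j k : Fin 7) : cubicValueIndex c i j k < 399 := by
  have := (cubicTriples_getD_cubicIndex i j k).1
  unfold cubicValueIndex
  omega

theorem unknowns_valueIndex {K : Type*} (v : Fin 21 → Fin 7 → K)
    (τ : Fin 3 → Fin 7 → Fin 7 → Fin 7 → K) (j : Fin 21) (l : Fin 7) :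
    unknowns v τ (valueIndex j l) = v j l := by
  rw [unknowns, if_pos (valueIndex_lt j l)]
  congr 1
  · ext
    simp only [valueIndex, Fin.val_ofNat]
    omega
  · ext
    simp only [valueIndex, Fin.val_ofNat]
    omega

theorem unknowns_cubicValueIndex {K : Type*} (v : Fin 21 → Fin 7 → K)
    (τ : Fin 3 → Fin 7 → Fin 7 → Fin 7 → K)
    (hτ₁ : ∀ c i j k, τ c i j k = τ c j i k) (hτ₂ : ∀ c i j k, τ c i j k = τ c i k j)
    (c : Fin 3) (i j k : Fin 7) :
    unknowns v τ (cubicValueIndex c i j k) = τ c i j k := by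
  obtain ⟨hlt, hmem⟩ := cubicTriples_getD_cubicIndex i j k
  have h1 : (cubicValueIndex c i j k - 147) % 84 = cubicIndex i j k := by
    unfold cubicValueIndex
    omega
  have h2 : Fin.ofNat 3 ((cubicValueIndex c i j k - 147) / 84) = c := by
    ext
    simp only [cubicValueIndex, Fin.val_ofNat]
    omega
  rw [unknowns, if_neg (by unfold cubicValueIndex; omega), h1, h2]
  simp only [List.mem_cons, List.not_mem_nil, or_false] at hmem
  rcases hmem with h | h | h | h | h | h <;> rw [h]
  · exact (hτ₂ _ _ _ _).symm
  · exact hτ₁ _ _ _ _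
  · rw [hτ₂, hτ₁]
  · rw [hτ₁, hτ₂]
  · rw [hτ₁, hτ₂, hτ₁]

theorem eq_zero_of_syzygySystem {K : Type*} [Field K] [CharZero K]
    (γ : Fin 7 → Fin 7 → Fin 3 → ℤ) (norm : List (Fin 21 × Fin 7))
    (hcert : certMod2 399 (syzygySystem γ norm) = true)
    (v : Fin 21 → Fin 7 → K) (τ : Fin 3 → Fin 7 → Fin 7 → Fin 7 → K)
    (hτ₁ : ∀ c i j k, τ c i j k = τ c j i k) (hτ₂ : ∀ c i j k, τ c i j k = τ c i k j)
    (hnorm : ∀ t ∈ norm, v t.1 t.2 = 0)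
    (heq : ∀ c k j, τ c k (leadPair j).1 (leadPair j).2 -
      ∑ l, (mulCoeff (leadPair j).1 (leadPair j).2 l : K) *
        τ c k (stdPair l).1 (stdPair l).2 = ∑ l, (γ k l c : K) * v j l) :
    (∀ j l, v j l = 0) ∧ ∀ c i j k, τ c i j k = 0 := by
  have h := eq_zero_of_certMod2 hcert (unknowns v τ) (by
    intro row hrow
    rw [syzygySystem, List.mem_append] at hrow
    rcases hrow with hrow | hrow
    · obtain ⟨t, ht, rfl⟩ := List.mem_map.mp hrow
      simp [rowEval, unknowns_valueIndex, hnorm t ht]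
    · simp only [List.mem_flatMap, List.mem_map] at hrow
      obtain ⟨c, -, k, -, j, -, rfl⟩ := hrow
      have h1 := heq c k j
      simp only [rowEval, syzygyRow, List.map_cons, List.map_append, List.map_map,
        Function.comp_def, List.sum_cons, List.sum_append, unknowns_valueIndex,
        unknowns_cubicValueIndex v τ hτ₁ hτ₂, Int.cast_one, one_mul, Int.cast_neg, neg_mul]
      simp only [← List.ofFn_eq_map, List.sum_ofFn, Finset.sum_neg_distrib]
      linear_combination h1)
  refine ⟨fun j l => ?_, fun c i j k => ?_⟩
  · rw [← unknowns_valueIndex v τ]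
    exact h _ ((valueIndex_lt j l).trans (by norm_num))
  · rw [← unknowns_cubicValueIndex v τ hτ₁ hτ₂]
    exact h _ (cubicValueIndex_lt c i j k)

theorem certMod2_coeffDegOne :
    certMod2 399 (syzygySystem coeffDegOne (List.ofFn normPair)) = true := by
  decide +kernel

theorem certMod2_coeffDegTwo :
    certMod2 399 (syzygySystem coeffDegTwo ((List.finRange 21).flatMap fun j =>
      (List.finRange 6).map fun l => (j, l.succ))) = true := by
  decide +kernel

section Functionals

variable (K : Type) [Field K]

/-- The reduced point of the scheme defined by `aGens`. -/
def reducedPoint (i : Fin 7) : ℤ := ![-1, 3, -1, 3, 19, -22, -12] i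

/-- Evaluation at the reduced point. -/
noncomputable def evalPoint : MvPolynomial (Fin 7) K →ₗ[K] K :=
  (aeval fun i => (reducedPoint i : K)).toLinearMap

/-- Evaluation at the origin. -/
noncomputable def evalOrigin : MvPolynomial (Fin 7) K →ₗ[K] K :=
  (aeval fun _ => (0 : K)).toLinearMap

/-- The linear coefficients at the origin. -/
noncomputable def linCoord (j : Fin 7) : MvPolynomial (Fin 7) K →ₗ[K] K :=
  evalOrigin K ∘ₗ (pderiv j).toLinearMap

/-- The coordinates of the quadratic part at the origin in the local algebra. -/
noncomputable def quadCoord (k : Fin 7) : MvPolynomial (Fin 7) K →ₗ[K] K :=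
  ∑ i, ∑ j, ((mulCoeff i j k : K) / 2) •
    (evalOrigin K ∘ₗ (pderiv i).toLinearMap ∘ₗ (pderiv j).toLinearMap)

variable {K}

@[simp] theorem evalPoint_mul (f g : MvPolynomial (Fin 7) K) :
    evalPoint K (f * g) = evalPoint K f * evalPoint K g := by simp [evalPoint]

@[simp] theorem evalPoint_X (i : Fin 7) : evalPoint K (X i) = reducedPoint i := by
  simp [evalPoint]

@[simp] theorem evalPoint_one : evalPoint K 1 = 1 := by simp [evalPoint]

@[simp] theorem evalPoint_C (c : K) : evalPoint K (C c) = c := by simp [evalPoint]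

@[simp] theorem evalPoint_pow (f : MvPolynomial (Fin 7) K) (n : ℕ) :
    evalPoint K (f ^ n) = evalPoint K f ^ n := by simp [evalPoint]

@[simp] theorem evalOrigin_one : evalOrigin K 1 = 1 := by simp [evalOrigin]

@[simp] theorem evalOrigin_C (c : K) : evalOrigin K (C c) = c := by simp [evalOrigin]

theorem evalOrigin_mul (f g : MvPolynomial (Fin 7) K) :
    evalOrigin K (f * g) = evalOrigin K f * evalOrigin K g := by simp [evalOrigin]

@[simp] theorem evalOrigin_X (i : Fin 7) : evalOrigin K (X i) = 0 := by simp [evalOrigin]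

@[simp] theorem evalOrigin_X_mul (i : Fin 7) (f : MvPolynomial (Fin 7) K) :
    evalOrigin K (X i * f) = 0 := by simp [evalOrigin]

@[simp] theorem linCoord_one (j : Fin 7) : linCoord K j 1 = 0 := by simp [linCoord]

@[simp] theorem linCoord_C (j : Fin 7) (c : K) : linCoord K j (C c) = 0 := by
  simp [linCoord]

@[simp] theorem linCoord_X (i j : Fin 7) : linCoord K j (X i) = if i = j then 1 else 0 := by
  by_cases h : i = j <;> simp [linCoord, pderiv_X, h]

@[simp] theorem linCoord_X_mul (i j : Fin 7) (f : MvPolynomial (Fin 7) K) :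
    linCoord K j (X i * f) = if i = j then evalOrigin K f else 0 := by
  by_cases h : i = j <;>
    simp [linCoord, Derivation.leibniz, pderiv_X, h, evalOrigin_mul]

theorem mulCoeff_comm (i j k : Fin 7) : mulCoeff i j k = mulCoeff j i k := by
  revert i j k; decide

@[simp] theorem quadCoord_one (k : Fin 7) : quadCoord K k 1 = 0 := by simp [quadCoord]

@[simp] theorem quadCoord_C (k : Fin 7) (c : K) : quadCoord K k (C c) = 0 := by
  simp [quadCoord]

variable [CharZero K]

@[simp] theorem quadCoord_X_mul (i k : Fin 7) (f : MvPolynomial (Fin 7) K) :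
    quadCoord K k (X i * f) = ∑ j, (mulCoeff i j k : K) * linCoord K j f := by
  have key (a b : Fin 7) : evalOrigin K (pderiv a (pderiv b (X i * f))) =
      (if i = b then linCoord K a f else 0) + if i = a then linCoord K b f else 0 := by
    have h (c : Fin 7) (g : MvPolynomial (Fin 7) K) :
        pderiv c (X i * g) = (if i = c then g else 0) + X i * pderiv c g := by
      rw [pderiv_mul, pderiv_X, Pi.single_apply, ite_mul, one_mul, zero_mul]
    rw [h, map_add, h, map_add, map_add, evalOrigin_X_mul, add_zero]
    congr 1
    · split_ifs <;> simp [linCoord]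
    · split_ifs <;> simp [linCoord]
  simp only [quadCoord, LinearMap.sum_apply, LinearMap.smul_apply, LinearMap.comp_apply,
    Derivation.coeFn_coe, key, smul_eq_mul, mul_add, Finset.sum_add_distrib, mul_ite, mul_zero,
    Finset.sum_ite_eq, Finset.mem_univ, if_true]
  rw [Finset.sum_comm]
  simp only [Finset.sum_ite_eq, Finset.mem_univ, if_true, ← Finset.sum_add_distrib]
  refine Finset.sum_congr rfl fun j _ => ?_
  rw [mulCoeff_comm j i]
  ring

@[simp] theorem quadCoord_X (i k : Fin 7) : quadCoord K k (X i) = 0 := by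
  simpa using quadCoord_X_mul i k (1 : MvPolynomial (Fin 7) K)

end Functionals

section Vanishing

variable {K : Type} [Field K]

theorem map_ofNat_mul_apply (φ : MvPolynomial (Fin 7) K →ₗ[K] K) (n : ℕ) [n.AtLeastTwo]
    (f : MvPolynomial (Fin 7) K) :
    φ (ofNat(n) * f) = ofNat(n) * φ f := by
  have h : (ofNat(n) : MvPolynomial (Fin 7) K) * f = (OfNat.ofNat n : ℕ) • f := by
    rw [nsmul_eq_mul, Nat.cast_ofNat]
  rw [h, map_nsmul, nsmul_eq_mul, Nat.cast_ofNat]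

theorem evalPoint_ofNat (n : ℕ) [n.AtLeastTwo] :
    evalPoint K ofNat(n) = ofNat(n) := by
  rw [← mul_one (ofNat(n) : MvPolynomial (Fin 7) K), map_ofNat_mul_apply, evalPoint_one,
    mul_one]

variable (K) [CharZero K]

/-- The ideal on which all coordinate functionals vanish. -/
noncomputable def vanishingIdeal : Ideal (MvPolynomial (Fin 7) K) where
  carrier := {f | evalPoint K f = 0 ∧ evalOrigin K f = 0 ∧ (∀ j, linCoord K j f = 0) ∧
    ∀ k, quadCoord K k f = 0}
  zero_mem' := by simp
  add_mem' := by
    rintro f g ⟨h1, h2, h3, h4⟩ ⟨h1', h2', h3', h4'⟩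
    simp [h1, h2, h3, h4, h1', h2', h3', h4']
  smul_mem' := by
    intro r f hf
    induction r using MvPolynomial.induction_on with
    | C c =>
      obtain ⟨h1, h2, h3, h4⟩ := hf
      simp [← MvPolynomial.smul_eq_C_mul, h1, h2, h3, h4]
    | add p q hp hq =>
      obtain ⟨h1, h2, h3, h4⟩ := hp
      obtain ⟨h1', h2', h3', h4'⟩ := hq
      simp only [smul_eq_mul] at *
      simp only [Set.mem_ofPred_eq, add_mul, map_add]
      simp only [h1, h2, h3, h4, h1', h2', h3', h4']
      simp
    | mul_X p i hp =>
      obtain ⟨h1, h2, h3, h4⟩ := hp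
      simp only [smul_eq_mul] at *
      simp only [Set.mem_ofPred_eq, mul_comm p (X i), mul_assoc]
      refine ⟨by rw [evalPoint_mul, h1, mul_zero], by simp, fun j => ?_, fun k => ?_⟩
      · rw [linCoord_X_mul, h2, ite_self]
      · rw [quadCoord_X_mul]
        simp only [h3, mul_zero, Finset.sum_const_zero]

theorem span_aGens_le_vanishingIdeal : Ideal.span (aGens K) ≤ vanishingIdeal K := by
  rw [Ideal.span_le]
  intro f hf
  simp only [aGens, Set.mem_insert_iff, Set.mem_singleton_iff] at hf
  rcases hf with h | h | h | h | h | h | h | h | h | h | h | h | h | h | h | h | h | h | h | h |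
    h | h | h | h | h | h | h | h | h | h | h | h <;> subst h <;>
  · refine ⟨?_, ?_, fun j => ?_, fun k => ?_⟩
    · simp [evalPoint_ofNat, pow_succ, reducedPoint] <;> norm_num
    · simp [map_ofNat_mul_apply, pow_succ, neg_mul, mul_assoc]
    · simp [map_ofNat_mul_apply, pow_succ, neg_mul, mul_assoc]
    · simp [map_ofNat_mul_apply, pow_succ, neg_mul, mul_assoc] <;>
        (ring_nf; norm_cast; revert k; decide)

end Vanishing

section Spanning

variable (K : Type) [Field K]

/-- The ideal `𝔞`. -/
noncomputable abbrev aIdeal : Ideal (MvPolynomial (Fin 7) K) := Ideal.span (aGens K)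

/-- The standard quadratic monomials. -/
noncomputable def stdMon (l : Fin 7) : MvPolynomial (Fin 7) K :=
  X (stdPair l).1 * X (stdPair l).2

/-- The span of the cube of the first variable modulo `𝔞`. -/
noncomputable def cubePart : Submodule K (MvPolynomial (Fin 7) K) :=
  (aIdeal K).restrictScalars K ⊔ Submodule.span K {X 0 ^ 3}

/-- The span of the standard quadratic monomials and the cube of the first variable modulo `𝔞`. -/
noncomputable def quadPart : Submodule K (MvPolynomial (Fin 7) K) :=
  cubePart K ⊔ Submodule.span K (Set.range (stdMon K))

/-- The span of the sixteen basis monomials modulo `𝔞`. -/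
noncomputable def monsPart : Submodule K (MvPolynomial (Fin 7) K) :=
  (aIdeal K).restrictScalars K ⊔ Submodule.span K (Set.range (mons16 K))

variable {K}

theorem ofNat_mul_mem {N : Submodule K (MvPolynomial (Fin 7) K)} (n : ℕ) [n.AtLeastTwo]
    {f : MvPolynomial (Fin 7) K} (hf : f ∈ N) : ofNat(n) * f ∈ N := by
  have h : (ofNat(n) : MvPolynomial (Fin 7) K) * f = (OfNat.ofNat n : ℕ) • f := by
    rw [nsmul_eq_mul, Nat.cast_ofNat]
  rw [h]
  exact nsmul_mem hf _

theorem neg_ofNat_mul_mem {N : Submodule K (MvPolynomial (Fin 7) K)} (n : ℕ) [n.AtLeastTwo]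
    {f : MvPolynomial (Fin 7) K} (hf : f ∈ N) : -ofNat(n) * f ∈ N := by
  rw [neg_mul]
  exact neg_mem (ofNat_mul_mem n hf)

theorem aIdeal_le_cubePart {f : MvPolynomial (Fin 7) K} (hf : f ∈ aIdeal K) : f ∈ cubePart K :=
  Submodule.mem_sup_left hf

theorem cube_mem_cubePart : (X 0 ^ 3 : MvPolynomial (Fin 7) K) ∈ cubePart K :=
  Submodule.mem_sup_right (Submodule.mem_span_singleton_self _)

theorem cubePart_le_quadPart {f : MvPolynomial (Fin 7) K} (hf : f ∈ cubePart K) :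
    f ∈ quadPart K := Submodule.mem_sup_left hf

theorem stdMon_mem_quadPart (l : Fin 7) : stdMon K l ∈ quadPart K :=
  Submodule.mem_sup_right (Submodule.subset_span ⟨l, rfl⟩)

theorem mul_mem_cubePart {g f : MvPolynomial (Fin 7) K} (hg : g * X 0 ^ 3 ∈ cubePart K)
    (hf : f ∈ cubePart K) : g * f ∈ cubePart K := by
  obtain ⟨u, hu, v, hv, rfl⟩ := Submodule.mem_sup.1 hf
  obtain ⟨c, rfl⟩ := Submodule.mem_span_singleton.1 hv
  rw [mul_add, mul_smul_comm]
  exact add_mem (aIdeal_le_cubePart (Ideal.mul_mem_left _ _ hu)) (Submodule.smul_mem _ _ hg)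

theorem mul_mem_cubePart_of_quadPart {g f : MvPolynomial (Fin 7) K}
    (hg : g * X 0 ^ 3 ∈ cubePart K) (hm : ∀ l, g * stdMon K l ∈ cubePart K)
    (hf : f ∈ quadPart K) : g * f ∈ cubePart K := by
  obtain ⟨u, hu, v, hv, rfl⟩ := Submodule.mem_sup.1 hf
  rw [mul_add]
  refine add_mem (mul_mem_cubePart hg hu) ?_
  clear hf
  induction hv using Submodule.span_induction with
  | mem x hx => obtain ⟨l, rfl⟩ := hx; exact hm l
  | zero => rw [mul_zero]; exact zero_mem _
  | add x y _ _ hx hy => rw [mul_add]; exact add_mem hx hy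
  | smul c x _ hx => rw [mul_smul_comm]; exact Submodule.smul_mem _ _ hx

theorem mem_of_sub_mem {N : Submodule K (MvPolynomial (Fin 7) K)} {f g : MvPolynomial (Fin 7) K}
    (h : f - g ∈ N) (hg : g ∈ N) : f ∈ N := by
  simpa using add_mem h hg

theorem mem_of_add_mem {N : Submodule K (MvPolynomial (Fin 7) K)} {f g : MvPolynomial (Fin 7) K}
    (h : f + g ∈ N) (hg : g ∈ N) : f ∈ N := by
  simpa using sub_mem h hg

theorem exists_leadPair_or_stdPair (i j : Fin 7) :
    (∃ k, leadPair k = (i, j) ∨ leadPair k = (j, i)) ∨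
      ∃ l, stdPair l = (i, j) ∨ stdPair l = (j, i) := by
  revert i j; decide

theorem X_mul_X_mem_quadPart_of_leadPair (j : Fin 21) :
    (X (leadPair j).1 * X (leadPair j).2 : MvPolynomial (Fin 7) K) ∈ quadPart K := by
  have h : ∀ f ∈ aGens K, f ∈ quadPart K := fun f hf =>
    cubePart_le_quadPart (aIdeal_le_cubePart (Ideal.subset_span hf))
  have hc := cubePart_le_quadPart (cube_mem_cubePart (K := K))
  have h0 : (X 0 ^ 2 : MvPolynomial (Fin 7) K) ∈ quadPart K := by
    rw [pow_two]; exact stdMon_mem_quadPart (K := K) 0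
  have h1 : (X 0 * X 1 : MvPolynomial (Fin 7) K) ∈ quadPart K := stdMon_mem_quadPart (K := K) 1
  have h2 : (X 0 * X 2 : MvPolynomial (Fin 7) K) ∈ quadPart K := stdMon_mem_quadPart (K := K) 2
  have h3 : (X 0 * X 3 : MvPolynomial (Fin 7) K) ∈ quadPart K := stdMon_mem_quadPart (K := K) 3
  have h4 : (X 1 ^ 2 : MvPolynomial (Fin 7) K) ∈ quadPart K := by
    rw [pow_two]; exact stdMon_mem_quadPart (K := K) 4
  have h5 : (X 1 * X 2 : MvPolynomial (Fin 7) K) ∈ quadPart K := stdMon_mem_quadPart (K := K) 5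
  have h6 : (X 2 ^ 2 : MvPolynomial (Fin 7) K) ∈ quadPart K := by
    rw [pow_two]; exact stdMon_mem_quadPart (K := K) 6
  simp only [aGens, Set.mem_insert_iff, forall_eq_or_imp, forall_eq, Set.mem_singleton_iff] at h
  obtain ⟨g66, g56, g46, g36, g26, g16, g06, g55, g45, g35, g25, g15, g05, g44, g34, g24, g14,
    g04, g33, g23, g13, -⟩ := h
  rw [pow_two (X _)] at g66 g55 g44 g33
  fin_cases j
  on_goal 1 => refine mem_of_sub_mem g04 ?_
  on_goal 2 => refine mem_of_sub_mem g05 ?_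
  on_goal 3 => refine mem_of_sub_mem g06 ?_
  on_goal 4 => refine mem_of_sub_mem g13 ?_
  on_goal 5 => refine mem_of_sub_mem g14 ?_
  on_goal 6 => refine mem_of_sub_mem g15 ?_
  on_goal 7 => refine mem_of_sub_mem g16 ?_
  on_goal 8 => refine mem_of_sub_mem g23 ?_
  on_goal 9 => refine mem_of_sub_mem g24 ?_
  on_goal 10 => refine mem_of_sub_mem g25 ?_
  on_goal 11 => refine mem_of_sub_mem g26 ?_
  on_goal 12 => refine mem_of_sub_mem g33 ?_
  on_goal 13 => refine mem_of_sub_mem g34 ?_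
  on_goal 14 => refine mem_of_sub_mem g35 ?_
  on_goal 15 => refine mem_of_sub_mem g36 ?_
  on_goal 16 => refine mem_of_sub_mem g44 ?_
  on_goal 17 => refine mem_of_sub_mem g45 ?_
  on_goal 18 => refine mem_of_sub_mem g46 ?_
  on_goal 19 => refine mem_of_sub_mem g55 ?_
  on_goal 20 => refine mem_of_sub_mem g56 ?_
  on_goal 21 => refine mem_of_sub_mem g66 ?_
  all_goals
    with_reducible repeat' first
      | assumption
      | apply ofNat_mul_mem
      | apply neg_ofNat_mul_mem
      | apply add_mem
      | apply sub_mem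
      | apply neg_mem

theorem X_mul_X_mem_quadPart (i j : Fin 7) : (X i * X j : MvPolynomial (Fin 7) K) ∈ quadPart K := by
  rcases exists_leadPair_or_stdPair i j with ⟨k, h | h⟩ | ⟨k, h | h⟩
  · simpa [h] using X_mul_X_mem_quadPart_of_leadPair (K := K) k
  · simpa [h, mul_comm] using X_mul_X_mem_quadPart_of_leadPair (K := K) k
  · simpa [stdMon, h] using stdMon_mem_quadPart (K := K) k
  · simpa [stdMon, h, mul_comm] using stdMon_mem_quadPart (K := K) k

theorem X_mul_stdMon_mem_cubePart_of_lt (a l : Fin 7) (ha : a.val < 3) :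
    (X a * stdMon K l : MvPolynomial (Fin 7) K) ∈ cubePart K := by
  have h : ∀ f ∈ aGens K, f ∈ cubePart K := fun f hf =>
    aIdeal_le_cubePart (Ideal.subset_span hf)
  have hc := cube_mem_cubePart (K := K)
  simp only [aGens, Set.mem_insert_iff, forall_eq_or_imp, forall_eq, Set.mem_singleton_iff] at h
  obtain ⟨-, -, -, -, -, -, -, -, -, -, -, -, -, -, -, -, -, -, -, -, -, g003, g222, g122, g022,
    g112, g012, g002, g111, g011, g001, g0000⟩ := h
  replace g003 := mem_of_add_mem g003 (ofNat_mul_mem 3 hc)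
  replace g222 := mem_of_sub_mem g222 hc
  replace g122 := mem_of_add_mem g122 (ofNat_mul_mem 3 hc)
  replace g022 := mem_of_sub_mem g022 hc
  replace g112 := mem_of_sub_mem g112 (ofNat_mul_mem 9 hc)
  replace g012 := mem_of_add_mem g012 (ofNat_mul_mem 3 hc)
  replace g002 := mem_of_sub_mem g002 hc
  replace g111 := mem_of_add_mem g111 (ofNat_mul_mem 27 hc)
  replace g011 := mem_of_sub_mem g011 (ofNat_mul_mem 9 hc)
  replace g001 := mem_of_add_mem g001 (ofNat_mul_mem 3 hc)
  replace g0000 := mem_of_add_mem g0000 hc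
  have tr {f g : MvPolynomial (Fin 7) K} (h : f ∈ cubePart K) (e : g = f) : g ∈ cubePart K :=
    e ▸ h
  have h0 : (X 0 * X 0 ^ 3 : MvPolynomial (Fin 7) K) ∈ cubePart K := tr g0000 (by ring)
  have hX : ∀ l, (X 0 * stdMon K l : MvPolynomial (Fin 7) K) ∈ cubePart K := by
    intro l
    fin_cases l
    · exact tr (g := X 0 * (X 0 * X 0)) hc (by ring)
    · exact tr (g := X 0 * (X 0 * X 1)) g001 (by ring)
    · exact tr (g := X 0 * (X 0 * X 2)) g002 (by ring)
    · exact tr (g := X 0 * (X 0 * X 3)) g003 (by ring)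
    · exact tr (g := X 0 * (X 1 * X 1)) g011 (by ring)
    · exact tr (g := X 0 * (X 1 * X 2)) g012 (by ring)
    · exact tr (g := X 0 * (X 2 * X 2)) g022 (by ring)
  have h3 (i : Fin 7) : (X i * (X 0 * X 3) : MvPolynomial (Fin 7) K) ∈ cubePart K :=
    tr (mul_mem_cubePart_of_quadPart h0 hX (X_mul_X_mem_quadPart i 3)) (by ring)
  obtain rfl | rfl | rfl : a = 0 ∨ a = 1 ∨ a = 2 := by omega
  · exact hX l
  · fin_cases l
    · exact tr (g := X 1 * (X 0 * X 0)) g001 (by ring)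
    · exact tr (g := X 1 * (X 0 * X 1)) g011 (by ring)
    · exact tr (g := X 1 * (X 0 * X 2)) g012 (by ring)
    · exact h3 1
    · exact tr (g := X 1 * (X 1 * X 1)) g111 (by ring)
    · exact tr (g := X 1 * (X 1 * X 2)) g112 (by ring)
    · exact tr (g := X 1 * (X 2 * X 2)) g122 (by ring)
  · fin_cases l
    · exact tr (g := X 2 * (X 0 * X 0)) g002 (by ring)
    · exact tr (g := X 2 * (X 0 * X 1)) g012 (by ring)
    · exact tr (g := X 2 * (X 0 * X 2)) g022 (by ring)
    · exact h3 2
    · exact tr (g := X 2 * (X 1 * X 1)) g112 (by ring)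
    · exact tr (g := X 2 * (X 1 * X 2)) g122 (by ring)
    · exact tr (g := X 2 * (X 2 * X 2)) g222 (by ring)

theorem X_mul_cube_mem_cubePart (i : Fin 7) :
    (X i * X 0 ^ 3 : MvPolynomial (Fin 7) K) ∈ cubePart K := by
  have h0 : (X 0 * X 0 ^ 3 : MvPolynomial (Fin 7) K) ∈ cubePart K := by
    have h : (X 0 ^ 4 + X 0 ^ 3 : MvPolynomial (Fin 7) K) ∈ cubePart K :=
      aIdeal_le_cubePart (Ideal.subset_span (by simp [aGens]))
    convert mem_of_add_mem h cube_mem_cubePart using 1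
    ring
  have h1 (f : MvPolynomial (Fin 7) K) (hf : f ∈ quadPart K) : X 0 * f ∈ cubePart K :=
    mul_mem_cubePart_of_quadPart h0
      (fun l => X_mul_stdMon_mem_cubePart_of_lt 0 l (by decide)) hf
  have h2 := mul_mem_cubePart h0 (h1 _ (X_mul_X_mem_quadPart i 0))
  convert h2 using 1
  ring

theorem X_mul_mem_cubePart_of_quadPart (i : Fin 7) {f : MvPolynomial (Fin 7) K}
    (hf : f ∈ quadPart K) : X i * f ∈ cubePart K := by
  refine mul_mem_cubePart_of_quadPart (X_mul_cube_mem_cubePart i) (fun l => ?_) hf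
  have hlt : ∀ l, (stdPair l).1.val < 3 := by decide
  have h := mul_mem_cubePart_of_quadPart (X_mul_cube_mem_cubePart (stdPair l).1)
    (fun m => X_mul_stdMon_mem_cubePart_of_lt _ m (hlt l))
    (X_mul_X_mem_quadPart (K := K) i (stdPair l).2)
  rwa [mul_left_comm] at h

theorem mons16_mem_monsPart (i : Fin 16) : mons16 K i ∈ monsPart K :=
  Submodule.mem_sup_right (Submodule.subset_span ⟨i, rfl⟩)

theorem cubePart_le_monsPart : cubePart K ≤ monsPart K := by
  refine sup_le_sup_left (Submodule.span_mono ?_) _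
  rintro _ rfl
  exact ⟨15, rfl⟩

theorem quadPart_le_monsPart : quadPart K ≤ monsPart K := by
  refine sup_le cubePart_le_monsPart (Submodule.span_le.2 ?_)
  rintro _ ⟨l, rfl⟩
  have h (i : Fin 16) (e : stdMon K l = mons16 K i) : stdMon K l ∈ monsPart K :=
    e ▸ mons16_mem_monsPart i
  fin_cases l
  · exact h 8 (pow_two _).symm
  · exact h 9 rfl
  · exact h 10 rfl
  · exact h 11 rfl
  · exact h 12 (pow_two _).symm
  · exact h 13 rfl
  · exact h 14 (pow_two _).symm

theorem X_mul_mons16_mem_monsPart (i : Fin 7) (m : Fin 16) :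
    X i * mons16 K m ∈ monsPart K := by
  have hX (j : Fin 7) : X i * X j ∈ monsPart K := quadPart_le_monsPart (X_mul_X_mem_quadPart i j)
  have hs (l : Fin 7) : X i * stdMon K l ∈ monsPart K :=
    cubePart_le_monsPart (X_mul_mem_cubePart_of_quadPart i (stdMon_mem_quadPart l))
  fin_cases m
  · show X i * 1 ∈ _
    rw [mul_one]
    have h (j : Fin 16) (e : X i = mons16 K j) : X i ∈ monsPart K := e ▸ mons16_mem_monsPart j
    fin_cases i
    · exact h 1 rfl
    · exact h 2 rfl
    · exact h 3 rfl
    · exact h 4 rfl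
    · exact h 5 rfl
    · exact h 6 rfl
    · exact h 7 rfl
  · exact hX 0
  · exact hX 1
  · exact hX 2
  · exact hX 3
  · exact hX 4
  · exact hX 5
  · exact hX 6
  · show X i * X 0 ^ 2 ∈ _
    rw [pow_two]
    exact hs 0
  · exact hs 1
  · exact hs 2
  · exact hs 3
  · show X i * X 1 ^ 2 ∈ _
    rw [pow_two]
    exact hs 4
  · exact hs 5
  · show X i * X 2 ^ 2 ∈ _
    rw [pow_two]
    exact hs 6
  · exact cubePart_le_monsPart (X_mul_cube_mem_cubePart i)

theorem monsPart_eq_top : monsPart K = ⊤ := by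
  refine Submodule.eq_top_iff'.2 fun f => ?_
  induction f using MvPolynomial.induction_on with
  | C c =>
    rw [← mul_one (C c), ← smul_eq_C_mul]
    exact Submodule.smul_mem _ _ (mons16_mem_monsPart 0)
  | add p q hp hq => exact add_mem hp hq
  | mul_X p i hp =>
    obtain ⟨u, hu, v, hv, rfl⟩ := Submodule.mem_sup.1 hp
    rw [mul_comm, mul_add]
    refine add_mem (Submodule.mem_sup_left (Ideal.mul_mem_left _ _ hu)) ?_
    clear hp
    induction hv using Submodule.span_induction with
    | mem x hx => obtain ⟨m, rfl⟩ := hx; exact X_mul_mons16_mem_monsPart i m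
    | zero => rw [mul_zero]; exact zero_mem _
    | add x y _ _ hx hy => rw [mul_add]; exact add_mem hx hy
    | smul c x _ hx => rw [mul_smul_comm]; exact Submodule.smul_mem _ _ hx

variable (K) in
theorem span_mk_mons16 :
    Submodule.span K (Set.range fun i => Ideal.Quotient.mk (aIdeal K) (mons16 K i)) = ⊤ := by
  refine Submodule.eq_top_iff'.2 fun b => ?_
  obtain ⟨f, rfl⟩ := Ideal.Quotient.mk_surjective b
  have hf : f ∈ monsPart K := by rw [monsPart_eq_top]; trivial
  obtain ⟨u, hu, v, hv, rfl⟩ := Submodule.mem_sup.1 hf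
  obtain ⟨c, rfl⟩ := (Submodule.mem_span_range_iff_exists_fun K).1 hv
  rw [map_add, Ideal.Quotient.eq_zero_iff_mem.2 hu, zero_add, map_sum]
  exact sum_mem fun i _ => Submodule.smul_mem _ (c i) (Submodule.subset_span (Set.mem_range_self i))

end Spanning

section Basis

variable {K : Type} [Field K] [CharZero K]

theorem eq_zero_of_sum_smul_mons16_mem (c : Fin 16 → K)
    (h : ∑ i, c i • mons16 K i ∈ vanishingIdeal K) : c = 0 := by
  obtain ⟨h1, h2, h3, h4⟩ := h
  simp only [Fin.sum_univ_succ, Fin.forall_fin_succ, mons16] at h1 h2 h3 h4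
  simp [pow_succ, mul_assoc, reducedPoint, mulCoeff] at h1 h2 h3 h4
  have h5 : c 15 = 0 := by simpa [h2, h3, h4] using h1
  funext i
  simp only [Pi.zero_apply]
  revert i
  simp only [Fin.forall_fin_succ]
  simp [h2, h3, h4, h5]

theorem mem_aIdeal_iff (f : MvPolynomial (Fin 7) K) :
    f ∈ aIdeal K ↔ evalPoint K f = 0 ∧ evalOrigin K f = 0 ∧ (∀ j, linCoord K j f = 0) ∧
      ∀ k, quadCoord K k f = 0 := by
  refine ⟨fun h => span_aGens_le_vanishingIdeal K h, fun h => ?_⟩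
  have hf : f ∈ monsPart K := by rw [monsPart_eq_top]; trivial
  obtain ⟨u, hu, v, hv, rfl⟩ := Submodule.mem_sup.1 hf
  obtain ⟨c, rfl⟩ := (Submodule.mem_span_range_iff_exists_fun K).1 hv
  have hv : ∑ i, c i • mons16 K i ∈ vanishingIdeal K := by
    have h' : u + ∑ i, c i • mons16 K i ∈ vanishingIdeal K := h
    simpa using sub_mem h' (span_aGens_le_vanishingIdeal K hu)
  rw [eq_zero_of_sum_smul_mons16_mem c hv]
  simpa using hu

variable (K) in
theorem linearIndependent_mk_mons16 :
    LinearIndependent K fun i => Ideal.Quotient.mk (aIdeal K) (mons16 K i) := by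
  refine Fintype.linearIndependent_iff.2 fun c h => ?_
  have h' : Ideal.Quotient.mk (aIdeal K) (∑ i, c i • mons16 K i) = 0 := by
    rw [← h, map_sum]
    rfl
  exact congrFun (eq_zero_of_sum_smul_mons16_mem c
    (span_aGens_le_vanishingIdeal K (Ideal.Quotient.eq_zero_iff_mem.1 h')))

variable (K) in
theorem finrank_quotient : Module.finrank K (MvPolynomial (Fin 7) K ⧸ aIdeal K) = 16 := by
  rw [Module.finrank_eq_card_basis (Module.Basis.mk (linearIndependent_mk_mons16 K)
    (span_mk_mons16 K).ge), Fintype.card_fin]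

end Basis

section QuotientFunctionals

variable {K : Type} [Field K]

/-- The functional on the quotient by `𝔞` induced by a functional vanishing on `𝔞`. -/
noncomputable def quotFunctional (φ : MvPolynomial (Fin 7) K →ₗ[K] K)
    (h : ∀ f ∈ aIdeal K, φ f = 0) : (MvPolynomial (Fin 7) K ⧸ aIdeal K) →ₗ[K] K :=
  ((aIdeal K).restrictScalars K).liftQ φ h ∘ₗ
    (Submodule.Quotient.restrictScalarsEquiv K (aIdeal K)).symm.toLinearMap

variable (K) [CharZero K]

/-- Evaluation at the reduced point on the quotient. -/
noncomputable def ptB : (MvPolynomial (Fin 7) K ⧸ aIdeal K) →ₗ[K] K :=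
  quotFunctional (evalPoint K) fun f hf => ((mem_aIdeal_iff f).1 hf).1

/-- Evaluation at the origin on the quotient. -/
noncomputable def c0B : (MvPolynomial (Fin 7) K ⧸ aIdeal K) →ₗ[K] K :=
  quotFunctional (evalOrigin K) fun f hf => ((mem_aIdeal_iff f).1 hf).2.1

/-- The linear coordinates at the origin on the quotient. -/
noncomputable def c1B (j : Fin 7) : (MvPolynomial (Fin 7) K ⧸ aIdeal K) →ₗ[K] K :=
  quotFunctional (linCoord K j) fun f hf => ((mem_aIdeal_iff f).1 hf).2.2.1 j

/-- The quadratic coordinates at the origin on the quotient. -/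
noncomputable def c2B (k : Fin 7) : (MvPolynomial (Fin 7) K ⧸ aIdeal K) →ₗ[K] K :=
  quotFunctional (quadCoord K k) fun f hf => ((mem_aIdeal_iff f).1 hf).2.2.2 k

variable {K}

@[simp] theorem ptB_mk (f : MvPolynomial (Fin 7) K) :
    ptB K (Ideal.Quotient.mk _ f) = evalPoint K f := rfl

@[simp] theorem c0B_mk (f : MvPolynomial (Fin 7) K) :
    c0B K (Ideal.Quotient.mk _ f) = evalOrigin K f := rfl

@[simp] theorem c1B_mk (j : Fin 7) (f : MvPolynomial (Fin 7) K) :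
    c1B K j (Ideal.Quotient.mk _ f) = linCoord K j f := rfl

@[simp] theorem c2B_mk (k : Fin 7) (f : MvPolynomial (Fin 7) K) :
    c2B K k (Ideal.Quotient.mk _ f) = quadCoord K k f := rfl

theorem quotient_eq_zero {b : MvPolynomial (Fin 7) K ⧸ aIdeal K} (h : ptB K b = 0)
    (h0 : c0B K b = 0) (h1 : ∀ j, c1B K j b = 0) (h2 : ∀ k, c2B K k b = 0) : b = 0 := by
  obtain ⟨f, rfl⟩ := Ideal.Quotient.mk_surjective b
  exact Ideal.Quotient.eq_zero_iff_mem.2 ((mem_aIdeal_iff f).2 ⟨h, h0, h1, h2⟩)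

theorem ptB_smul (f : MvPolynomial (Fin 7) K) (b : MvPolynomial (Fin 7) K ⧸ aIdeal K) :
    ptB K (f • b) = evalPoint K f * ptB K b := by
  obtain ⟨g, rfl⟩ := Ideal.Quotient.mk_surjective b
  exact evalPoint_mul f g

@[simp] theorem c0B_X_smul (i : Fin 7) (b : MvPolynomial (Fin 7) K ⧸ aIdeal K) :
    c0B K ((X i : MvPolynomial (Fin 7) K) • b) = 0 := by
  obtain ⟨g, rfl⟩ := Ideal.Quotient.mk_surjective b
  exact evalOrigin_X_mul i g

@[simp] theorem c1B_X_smul (i j : Fin 7) (b : MvPolynomial (Fin 7) K ⧸ aIdeal K) :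
    c1B K j ((X i : MvPolynomial (Fin 7) K) • b) = if i = j then c0B K b else 0 := by
  obtain ⟨g, rfl⟩ := Ideal.Quotient.mk_surjective b
  exact linCoord_X_mul i j g

@[simp] theorem c2B_X_smul (i k : Fin 7) (b : MvPolynomial (Fin 7) K ⧸ aIdeal K) :
    c2B K k ((X i : MvPolynomial (Fin 7) K) • b) =
      ∑ j, (mulCoeff i j k : K) * c1B K j b := by
  obtain ⟨g, rfl⟩ := Ideal.Quotient.mk_surjective b
  exact quadCoord_X_mul i k g

end QuotientFunctionals

section Splitting

variable (K : Type) [Field K]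

/-- The idempotent of the quotient supported at the origin. -/
noncomputable def localIdem : MvPolynomial (Fin 7) K := 1 + X 0 * (X 0 * X 0)

/-- The idempotent of the quotient supported at the reduced point. -/
noncomputable def pointIdem : MvPolynomial (Fin 7) K := -(X 0 * (X 0 * X 0))

/-- The polynomials lying in `𝔞` locally at the origin. -/
noncomputable def localIdeal : Ideal (MvPolynomial (Fin 7) K) :=
  Submodule.comap (LinearMap.mulLeft _ (localIdem K)) (aIdeal K)

/-- The polynomials lying in `𝔞` locally at the reduced point. -/
noncomputable def pointIdeal : Ideal (MvPolynomial (Fin 7) K) :=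
  Submodule.comap (LinearMap.mulLeft _ (pointIdem K)) (aIdeal K)

/-- Multiplication by the local idempotent. -/
noncomputable def localMap : localIdeal K →ₗ[MvPolynomial (Fin 7) K] aIdeal K :=
  (LinearMap.mulLeft _ (localIdem K)).restrict fun _ h => h

/-- Multiplication by the idempotent of the reduced point. -/
noncomputable def pointMap : pointIdeal K →ₗ[MvPolynomial (Fin 7) K] aIdeal K :=
  (LinearMap.mulLeft _ (pointIdem K)).restrict fun _ h => h

variable {K}

theorem coe_localMap (f : localIdeal K) :
    (localMap K f : MvPolynomial (Fin 7) K) = localIdem K * f := rfl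

theorem coe_pointMap (f : pointIdeal K) :
    (pointMap K f : MvPolynomial (Fin 7) K) = pointIdem K * f := rfl

@[simp] theorem evalPoint_localIdem : evalPoint K (localIdem K) = 0 := by
  simp [localIdem, reducedPoint]

@[simp] theorem evalPoint_pointIdem : evalPoint K (pointIdem K) = 1 := by
  simp [pointIdem, reducedPoint]

theorem aIdeal_le_localIdeal : aIdeal K ≤ localIdeal K := fun _ h => Ideal.mul_mem_left _ _ h

theorem aIdeal_le_pointIdeal : aIdeal K ≤ pointIdeal K := fun _ h => Ideal.mul_mem_left _ _ h

@[simp] theorem linCoord_stdMon (k l : Fin 7) : linCoord K k (stdMon K l) = 0 := by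
  simp [stdMon]

@[simp] theorem evalOrigin_stdMon (l : Fin 7) : evalOrigin K (stdMon K l) = 0 := by
  simp [stdMon]

theorem localMap_eq_smul (f : aIdeal K) :
    localMap K ⟨f, aIdeal_le_localIdeal f.2⟩ = localIdem K • f := rfl

theorem pointMap_eq_smul (f : aIdeal K) :
    pointMap K ⟨f, aIdeal_le_pointIdeal f.2⟩ = pointIdem K • f := rfl

variable [CharZero K]

theorem mem_localIdeal_iff (f : MvPolynomial (Fin 7) K) :
    f ∈ localIdeal K ↔ evalOrigin K f = 0 ∧ (∀ j, linCoord K j f = 0) ∧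
      ∀ k, quadCoord K k f = 0 := by
  change localIdem K * f ∈ aIdeal K ↔ _
  rw [mem_aIdeal_iff, evalPoint_mul, evalPoint_localIdem]
  simp [localIdem, add_mul, mul_assoc]

theorem mem_pointIdeal_iff (f : MvPolynomial (Fin 7) K) :
    f ∈ pointIdeal K ↔ evalPoint K f = 0 := by
  change pointIdem K * f ∈ aIdeal K ↔ _
  rw [mem_aIdeal_iff, evalPoint_mul, evalPoint_pointIdem]
  simp [pointIdem, mul_assoc]

@[simp] theorem quadCoord_stdMon (k l : Fin 7) :
    quadCoord K k (stdMon K l) = if l = k then 1 else 0 := by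
  have h : ∀ k l, mulCoeff (stdPair l).1 (stdPair l).2 k = if l = k then 1 else 0 := by decide
  simp [stdMon, h]

variable (K) in
/-- The quadratic relations of the local algebra at the origin. -/
noncomputable def quadRel (i j : Fin 7) : localIdeal K :=
  ⟨X i * X j - ∑ l, (mulCoeff i j l : K) • stdMon K l, by
    rw [mem_localIdeal_iff]
    simp⟩

variable (K) in
/-- The cubic monomials. -/
noncomputable def cubicMon (i j k : Fin 7) : localIdeal K :=
  ⟨X i * (X j * X k), by
    rw [mem_localIdeal_iff]
    simp⟩

variable (K) in
/-- The linear relations at the reduced point. -/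
noncomputable def pointRel (i : Fin 7) : pointIdeal K :=
  ⟨X i - C (reducedPoint i : K), by
    rw [mem_pointIdeal_iff, map_sub, evalPoint_X, evalPoint_C, sub_self]⟩

theorem coe_quadRel (i j : Fin 7) : (quadRel K i j : MvPolynomial (Fin 7) K) =
    X i * X j - ∑ l, (mulCoeff i j l : K) • stdMon K l := rfl

theorem coe_pointRel (i : Fin 7) : (pointRel K i : MvPolynomial (Fin 7) K) =
    X i - C (reducedPoint i : K) := rfl

theorem cubicMon_swap_left (i j k : Fin 7) : cubicMon K i j k = cubicMon K j i k :=
  Subtype.ext (mul_left_comm _ _ _)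

theorem cubicMon_swap_right (i j k : Fin 7) : cubicMon K i j k = cubicMon K i k j :=
  Subtype.ext (by simp [cubicMon, mul_comm])

theorem X_smul_quadRel (k i j : Fin 7) :
    (X k : MvPolynomial (Fin 7) K) • quadRel K i j =
      cubicMon K k i j - ∑ l, (mulCoeff i j l : K) • cubicMon K k (stdPair l).1 (stdPair l).2 := by
  apply Subtype.ext
  simp [quadRel, cubicMon, mul_sub, Finset.mul_sum, stdMon]

theorem mem_of_local_coords_eq_zero {M : Ideal (MvPolynomial (Fin 7) K)}
    (hq : ∀ i j, (quadRel K i j : MvPolynomial (Fin 7) K) ∈ M)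
    (hc : ∀ i j k, (X i * (X j * X k) : MvPolynomial (Fin 7) K) ∈ M)
    {f : MvPolynomial (Fin 7) K} (hf : f ∈ localIdeal K) : f ∈ M := by
  have key : f - (C (evalOrigin K f) + ∑ j, C (linCoord K j f) * X j +
      ∑ k, C (quadCoord K k f) * stdMon K k) ∈ M := by
    clear hf
    induction f using MvPolynomial.induction_on with
    | C c => simp
    | add p q hp hq =>
      convert add_mem hp hq using 1
      simp only [map_add, add_mul, Finset.sum_add_distrib]
      ring
    | mul_X p i hp =>
      rw [mul_comm p]
      have h1 := Ideal.mul_mem_left M (X i) hp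
      have h2 : ∑ j, C (linCoord K j p) * (quadRel K i j : MvPolynomial (Fin 7) K) +
          ∑ k, C (quadCoord K k p) * (X i * stdMon K k) ∈ M :=
        add_mem (sum_mem fun j _ => Ideal.mul_mem_left _ _ (hq i j))
          (sum_mem fun k _ => Ideal.mul_mem_left _ _ (hc _ _ _))
      convert add_mem h1 h2 using 1
      have h3 : ∑ k, C (quadCoord K k (X i * p)) * stdMon K k =
          ∑ j, C (linCoord K j p) * ∑ l, (mulCoeff i j l : K) • stdMon K l := by
        simp only [quadCoord_X_mul, map_sum, map_mul, Finset.sum_mul, Finset.mul_sum, smul_eq_C_mul]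
        rw [Finset.sum_comm]
        refine Finset.sum_congr rfl fun _ _ => Finset.sum_congr rfl fun _ _ => ?_
        ring
      have h4 : ∑ j, C (linCoord K j (X i * p)) * X j = C (evalOrigin K p) * X i := by
        simp [apply_ite C]
      rw [h3, h4, evalOrigin_X_mul, map_zero]
      simp only [quadRel, mul_sub, mul_add, Finset.sum_sub_distrib, Finset.mul_sum]
      have h5 : ∑ j, X i * (C (linCoord K j p) * X j) = ∑ j, C (linCoord K j p) * (X i * X j) :=
        Finset.sum_congr rfl fun _ _ => mul_left_comm _ _ _
      have h6 : ∑ k, X i * (C (quadCoord K k p) * stdMon K k) =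
          ∑ k, C (quadCoord K k p) * (X i * stdMon K k) :=
        Finset.sum_congr rfl fun _ _ => mul_left_comm _ _ _
      rw [h5, h6]
      ring
  obtain ⟨h0, h1, h2⟩ := (mem_localIdeal_iff f).1 hf
  simpa [h0, h1, h2] using key

theorem mem_of_evalPoint_eq_zero {M : Ideal (MvPolynomial (Fin 7) K)}
    (hM : ∀ i, (X i - C (reducedPoint i : K) : MvPolynomial (Fin 7) K) ∈ M)
    {f : MvPolynomial (Fin 7) K} (hf : f ∈ pointIdeal K) : f ∈ M := by
  have key : f - C (evalPoint K f) ∈ M := by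
    clear hf
    induction f using MvPolynomial.induction_on with
    | C c => simp
    | add p q hp hq =>
      convert add_mem hp hq using 1
      simp only [map_add]
      ring
    | mul_X p i hp =>
      convert add_mem (Ideal.mul_mem_left M (X i) hp)
        (Ideal.mul_mem_left M (C (evalPoint K p)) (hM i)) using 1
      simp only [evalPoint_mul, evalPoint_X, map_mul]
      ring
  rw [(mem_pointIdeal_iff f).1 hf] at key
  simpa using key

end Splitting

section Uniqueness

variable {K : Type} [Field K] [CharZero K]

theorem functional_X_smul_quadRel
    (g : localIdeal K →ₗ[MvPolynomial (Fin 7) K] MvPolynomial (Fin 7) K ⧸ aIdeal K)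
    (φ : (MvPolynomial (Fin 7) K ⧸ aIdeal K) →ₗ[K] K) (k i j : Fin 7) :
    φ (g (cubicMon K k i j)) -
      ∑ l, (mulCoeff i j l : K) * φ (g (cubicMon K k (stdPair l).1 (stdPair l).2)) =
      φ ((X k : MvPolynomial (Fin 7) K) • g (quadRel K i j)) := by
  rw [← map_smul, X_smul_quadRel, map_sub, map_sum, map_sub, map_sum]
  simp only [LinearMap.map_smul_of_tower, map_smul, smul_eq_mul]

theorem functional_localIdeal_eq_zero
    (g : localIdeal K →ₗ[MvPolynomial (Fin 7) K] MvPolynomial (Fin 7) K ⧸ aIdeal K)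
    (h1 : ∀ i, c1B K (normPair i).2
      (g (quadRel K (leadPair (normPair i).1).1 (leadPair (normPair i).1).2)) = 0)
    (h2 : ∀ j k, c2B K k (g (quadRel K (leadPair j).1 (leadPair j).2)) = 0)
    (f : localIdeal K) :
    c0B K (g f) = 0 ∧ (∀ j, c1B K j (g f) = 0) ∧ ∀ k, c2B K k (g f) = 0 := by
  have hs₁ (φ : (MvPolynomial (Fin 7) K ⧸ aIdeal K) →ₗ[K] K) (i j k : Fin 7) :
      φ (g (cubicMon K i j k)) = φ (g (cubicMon K j i k)) := by rw [cubicMon_swap_left]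
  have hs₂ (φ : (MvPolynomial (Fin 7) K ⧸ aIdeal K) →ₗ[K] K) (i j k : Fin 7) :
      φ (g (cubicMon K i j k)) = φ (g (cubicMon K i k j)) := by rw [cubicMon_swap_right]
  have q1 : ∀ j l, c1B K l (g (quadRel K (leadPair j).1 (leadPair j).2)) = 0 :=
    (eq_zero_of_syzygySystem coeffDegOne _ certMod2_coeffDegOne
      (fun j l => c1B K l (g (quadRel K (leadPair j).1 (leadPair j).2)))
      (fun c i j k => c2B K (c.castLE (by decide)) (g (cubicMon K i j k)))
      (fun c => hs₁ _) (fun c => hs₂ _)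
      (fun t ht => by obtain ⟨i, rfl⟩ := (List.mem_ofFn' _ _).1 ht; exact h1 i)
      (fun c k j => by
        rw [functional_X_smul_quadRel]
        simp [coeffDegOne])).1
  have q0 : ∀ j, c0B K (g (quadRel K (leadPair j).1 (leadPair j).2)) = 0 := fun j => by
    simpa using (eq_zero_of_syzygySystem coeffDegTwo _ certMod2_coeffDegTwo
      (fun j l => if l = 0 then c0B K (g (quadRel K (leadPair j).1 (leadPair j).2)) else 0)
      (fun c i j k => c1B K (c.castLE (by decide)) (g (cubicMon K i j k)))
      (fun c => hs₁ _) (fun c => hs₂ _)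
      (fun t ht => by
        simp only [List.mem_flatMap, List.mem_map] at ht
        obtain ⟨_, _, l, _, rfl⟩ := ht
        simp)
      (fun c k j => by
        rw [functional_X_smul_quadRel, c1B_X_smul]
        have hk : k = c.castLE (by decide) ↔ k.val = c.val := Fin.ext_iff
        by_cases h : k.val = c.val <;> simp [coeffDegTwo, hk, h])).1 j 0
  have hcub (φ : (MvPolynomial (Fin 7) K ⧸ aIdeal K) →ₗ[K] K)
      (hφ : ∀ k j, φ ((X k : MvPolynomial (Fin 7) K) •
        g (quadRel K (leadPair j).1 (leadPair j).2)) = 0) (i j k : Fin 7) :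
      φ (g (cubicMon K i j k)) = 0 :=
    (eq_zero_of_syzygySystem coeffDegOne _ certMod2_coeffDegOne 0
      (fun _ i j k => φ (g (cubicMon K i j k)))
      (fun c => hs₁ _) (fun c => hs₂ _) (fun t ht => rfl)
      (fun c k j => by
        rw [functional_X_smul_quadRel, hφ]
        simp)).2 0 i j k
  have hquad (φ : (MvPolynomial (Fin 7) K ⧸ aIdeal K) →ₗ[K] K)
      (hφ : ∀ j, φ (g (quadRel K (leadPair j).1 (leadPair j).2)) = 0) (i j : Fin 7) :
      φ (g (quadRel K i j)) = 0 := by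
    have hsymm : quadRel K i j = quadRel K j i := by
      apply Subtype.ext
      simp only [quadRel, mulCoeff_comm i j, mul_comm (X i : MvPolynomial (Fin 7) K)]
    have hstd (l : Fin 7) : quadRel K (stdPair l).1 (stdPair l).2 = 0 := by
      have h : ∀ k l, mulCoeff (stdPair l).1 (stdPair l).2 k = if l = k then 1 else 0 := by decide
      apply Subtype.ext
      simp [quadRel, h, stdMon]
    rcases exists_leadPair_or_stdPair i j with ⟨k, h | h⟩ | ⟨l, h | h⟩
    · simpa [h] using hφ k
    · simpa [h, hsymm] using hφ k
    · have := hstd l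
      simp only [h] at this
      simp [this]
    · have := hstd l
      simp only [h] at this
      simp [hsymm, this]
  let M : Submodule (MvPolynomial (Fin 7) K) (localIdeal K) :=
    { carrier := {f | c0B K (g f) = 0 ∧ (∀ j, c1B K j (g f) = 0) ∧ ∀ k, c2B K k (g f) = 0}
      zero_mem' := by simp
      add_mem' := by
        rintro p q ⟨hp0, hp1, hp2⟩ ⟨hq0, hq1, hq2⟩
        simp [hp0, hp1, hp2, hq0, hq1, hq2]
      smul_mem' := by
        intro r f hf
        induction r using MvPolynomial.induction_on generalizing f with
        | C c =>
          obtain ⟨h1, h2, h3⟩ := hf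
          have hc : (C c : MvPolynomial (Fin 7) K) • g f = c • g f := algebraMap_smul _ c (g f)
          simp [hc, h1, h2, h3]
        | add p q hp hq =>
          obtain ⟨hp0, hp1, hp2⟩ := hp hf
          obtain ⟨hq0, hq1, hq2⟩ := hq hf
          simp only [map_smul, Set.mem_ofPred_eq] at *
          simp [add_smul, hp0, hp1, hp2, hq0, hq1, hq2]
        | mul_X p i hp =>
          rw [mul_smul]
          refine hp ?_
          obtain ⟨h1, h2, h3⟩ := hf
          simp [h1, h2] }
  have hM : (f : MvPolynomial (Fin 7) K) ∈ M.map (localIdeal K).subtype := by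
    refine mem_of_local_coords_eq_zero (fun i j => Submodule.mem_map.2 ⟨quadRel K i j, ?_, rfl⟩)
      (fun i j k => Submodule.mem_map.2 ⟨cubicMon K i j k, ?_, rfl⟩) f.2
    · exact ⟨hquad _ q0 _ _, fun l => hquad _ (fun j => q1 j l) _ _,
        fun l => hquad _ (fun j => h2 j l) _ _⟩
    · refine ⟨hcub _ (fun k j => ?_) _ _ _, fun l => hcub _ (fun k j => ?_) _ _ _,
        fun l => hcub _ (fun k j => ?_) _ _ _⟩
      · simp
      · simp [q0]
      · simp [q1]
  obtain ⟨f', hf', e⟩ := hM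
  obtain rfl : f' = f := Subtype.ext e
  exact hf'

theorem ptB_pointIdeal_eq_zero
    (g : pointIdeal K →ₗ[MvPolynomial (Fin 7) K] MvPolynomial (Fin 7) K ⧸ aIdeal K)
    (h : ∀ i, ptB K (g (pointRel K i)) = 0) (f : pointIdeal K) : ptB K (g f) = 0 := by
  let M : Submodule (MvPolynomial (Fin 7) K) (pointIdeal K) :=
    { carrier := {f | ptB K (g f) = 0}
      zero_mem' := by simp
      add_mem' := by
        rintro p q hp hq
        simp_all
      smul_mem' := by
        intro r f hf
        simp_all [ptB_smul] }
  have hM : (f : MvPolynomial (Fin 7) K) ∈ M.map (pointIdeal K).subtype :=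
    mem_of_evalPoint_eq_zero
      (fun i => Submodule.mem_map.2 ⟨pointRel K i, h i, rfl⟩) f.2
  obtain ⟨f', hf', e⟩ := hM
  obtain rfl : f' = f := Subtype.ext e
  exact hf'

end Uniqueness

section Hessian

variable {K : Type} [Field K]

variable (K) in
/-- The second order partial derivatives at the origin. -/
noncomputable def hessian (a b : Fin 7) : MvPolynomial (Fin 7) K →ₗ[K] K :=
  linCoord K a ∘ₗ (pderiv b).toLinearMap

theorem hessian_apply (a b : Fin 7) (f : MvPolynomial (Fin 7) K) :
    hessian K a b f = linCoord K a (pderiv b f) := rfl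

theorem hessian_X_mul (a b i : Fin 7) (f : MvPolynomial (Fin 7) K) :
    hessian K a b (X i * f) =
      (if i = b then linCoord K a f else 0) + if i = a then linCoord K b f else 0 := by
  rw [hessian_apply, pderiv_mul, pderiv_X, Pi.single_apply, map_add, linCoord_X_mul, ite_mul,
    one_mul, zero_mul, apply_ite (linCoord K a), map_zero]
  rfl

/-- The second order partial derivatives of a quadratic monomial. -/
def hessianCoeff (a b i j : Fin 7) : ℤ :=
  (if i = b then if j = a then 1 else 0 else 0) + if i = a then if j = b then 1 else 0 else 0

theorem hessian_X_mul_X (a b i j : Fin 7) :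
    hessian K a b (X i * X j) = hessianCoeff a b i j := by
  rw [hessian_X_mul, linCoord_X, linCoord_X, hessianCoeff]
  push_cast
  rfl

/-- The homomorphism `𝔞 → R/𝔞` induced by the derivation with the given components. -/
noncomputable def derHom (d : Fin 7 → MvPolynomial (Fin 7) K) :
    aIdeal K →ₗ[MvPolynomial (Fin 7) K] MvPolynomial (Fin 7) K ⧸ aIdeal K where
  toFun f := Ideal.Quotient.mk _ (∑ i, d i * pderiv i (f : MvPolynomial (Fin 7) K))
  map_add' f g := by
    simp only [Submodule.coe_add, map_add, mul_add, Finset.sum_add_distrib]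
  map_smul' r f := by
    have h : ∑ i, d i * pderiv i (r * (f : MvPolynomial (Fin 7) K)) =
        (∑ i, d i * pderiv i r) * f + r * ∑ i, d i * pderiv i (f : MvPolynomial (Fin 7) K) := by
      rw [Finset.sum_mul, Finset.mul_sum, ← Finset.sum_add_distrib]
      refine Finset.sum_congr rfl fun i _ => ?_
      rw [pderiv_mul]
      ring
    change Ideal.Quotient.mk _ (∑ i, d i * pderiv i (r * (f : MvPolynomial (Fin 7) K))) = _
    rw [h, map_add, Ideal.Quotient.eq_zero_iff_mem.2 (Ideal.mul_mem_left _ _ f.2), zero_add]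
    rfl

theorem derHom_apply (d : Fin 7 → MvPolynomial (Fin 7) K) (f : aIdeal K) :
    derHom d f = Ideal.Quotient.mk _ (∑ i, d i * pderiv i (f : MvPolynomial (Fin 7) K)) := rfl

theorem hessian_localIdem_mul (a b : Fin 7) (f : MvPolynomial (Fin 7) K) :
    hessian K a b (localIdem K * f) = hessian K a b f := by
  simp [localIdem, add_mul, mul_assoc, hessian_X_mul]

end Hessian

section Coordinates

variable (K : Type) [Field K] [CharZero K]

/-- The coordinates of a homomorphism `𝔞 → R/𝔞`. -/
noncomputable def homCoords :
    (aIdeal K →ₗ[MvPolynomial (Fin 7) K] MvPolynomial (Fin 7) K ⧸ aIdeal K) →ₗ[K]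
      (Fin 21 → Fin 7 → K) × (Fin 7 → K) × (Fin 7 → K) where
  toFun h :=
    (fun j k => c2B K k (h (localMap K (quadRel K (leadPair j).1 (leadPair j).2))),
      fun i => c1B K (normPair i).2
        (h (localMap K (quadRel K (leadPair (normPair i).1).1 (leadPair (normPair i).1).2))),
      fun i => ptB K (h (pointMap K (pointRel K i))))
  map_add' g h := by
    simp only [LinearMap.add_apply, map_add]
    rfl
  map_smul' c h := by
    simp only [LinearMap.smul_apply, map_smul]
    rfl

variable {K}

theorem homCoords_fst (h : aIdeal K →ₗ[MvPolynomial (Fin 7) K] MvPolynomial (Fin 7) K ⧸ aIdeal K)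
    (j : Fin 21) (k : Fin 7) : (homCoords K h).1 j k =
      c2B K k (h (localMap K (quadRel K (leadPair j).1 (leadPair j).2))) := rfl

theorem homCoords_snd_fst
    (h : aIdeal K →ₗ[MvPolynomial (Fin 7) K] MvPolynomial (Fin 7) K ⧸ aIdeal K) (i : Fin 7) :
    (homCoords K h).2.1 i = c1B K (normPair i).2
      (h (localMap K (quadRel K (leadPair (normPair i).1).1 (leadPair (normPair i).1).2))) := rfl

theorem homCoords_snd_snd
    (h : aIdeal K →ₗ[MvPolynomial (Fin 7) K] MvPolynomial (Fin 7) K ⧸ aIdeal K) (i : Fin 7) :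
    (homCoords K h).2.2 i = ptB K (h (pointMap K (pointRel K i))) := rfl

theorem homCoords_injective : Function.Injective (homCoords K) := by
  refine (injective_iff_map_eq_zero _).2 fun h hh => LinearMap.ext fun f => ?_
  simp only [homCoords, LinearMap.coe_mk, AddHom.coe_mk, Prod.mk_eq_zero, funext_iff,
    Pi.zero_apply] at hh
  obtain ⟨h2, h1, hp⟩ := hh
  obtain ⟨f0, f1, f2⟩ := functional_localIdeal_eq_zero (h ∘ₗ localMap K) h1 h2
    ⟨f, aIdeal_le_localIdeal f.2⟩
  have fp := ptB_pointIdeal_eq_zero (h ∘ₗ pointMap K) hp ⟨f, aIdeal_le_pointIdeal f.2⟩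
  simp only [LinearMap.comp_apply, localMap_eq_smul, pointMap_eq_smul, map_smul] at f0 f1 f2 fp
  rw [ptB_smul, evalPoint_pointIdem, one_mul] at fp
  refine quotient_eq_zero fp ?_ (fun j => ?_) fun k => ?_
  · simpa [localIdem, add_smul, mul_smul] using f0
  · simpa [localIdem, add_smul, mul_smul] using f1 j
  · simpa [localIdem, add_smul, mul_smul] using f2 k

/-- The second order partial derivatives of a quadratic relation. -/
def hessianRel (a b i j : Fin 7) : ℤ :=
  hessianCoeff a b i j - ∑ l, mulCoeff i j l * hessianCoeff a b (stdPair l).1 (stdPair l).2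

theorem hessian_localMap_quadRel (a b i j : Fin 7) :
    hessian K a b (localMap K (quadRel K i j)) = hessianRel a b i j := by
  rw [coe_localMap, coe_quadRel, hessian_localIdem_mul, map_sub, map_sum, hessian_X_mul_X,
    hessianRel]
  simp [stdMon, hessian_X_mul_X]

theorem hessian_mul (a b : Fin 7) (r : MvPolynomial (Fin 7) K) {f : MvPolynomial (Fin 7) K}
    (hf : f ∈ aIdeal K) : hessian K a b (r * f) = evalOrigin K r * hessian K a b f := by
  induction r using MvPolynomial.induction_on with
  | C c => rw [← smul_eq_C_mul, map_smul, evalOrigin_C, smul_eq_mul]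
  | add p q hp hq => rw [add_mul, map_add, hp, hq, map_add, add_mul]
  | mul_X p i hp =>
    have h := ((mem_aIdeal_iff _).1 (Ideal.mul_mem_left _ p hf)).2.2.1
    rw [mul_comm p, mul_assoc, hessian_X_mul, h, h]
    simp

variable (K) in
/-- The standard quadratic monomials in the quotient, localised at the origin. -/
noncomputable def socleMon (k : Fin 7) : MvPolynomial (Fin 7) K ⧸ aIdeal K :=
  Ideal.Quotient.mk _ (localIdem K * stdMon K k)

@[simp] theorem c1B_socleMon (j k : Fin 7) : c1B K j (socleMon K k) = 0 := by
  rw [socleMon, c1B_mk]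
  simp [localIdem, add_mul, mul_assoc]

@[simp] theorem c2B_socleMon (j k : Fin 7) :
    c2B K j (socleMon K k) = if k = j then 1 else 0 := by
  rw [socleMon, c2B_mk]
  simp [localIdem, add_mul, mul_assoc]

@[simp] theorem ptB_socleMon (k : Fin 7) : ptB K (socleMon K k) = 0 := by
  rw [socleMon, ptB_mk, evalPoint_mul, evalPoint_localIdem, zero_mul]

@[simp] theorem c0B_socleMon (k : Fin 7) : c0B K (socleMon K k) = 0 := by
  rw [socleMon, c0B_mk]
  simp [localIdem, add_mul, mul_assoc]

theorem smul_socleMon (r : MvPolynomial (Fin 7) K) (k : Fin 7) :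
    r • socleMon K k = evalOrigin K r • socleMon K k := by
  induction r using MvPolynomial.induction_on with
  | C c => rw [evalOrigin_C]; exact algebraMap_smul _ c _
  | add p q hp hq => rw [add_smul, hp, hq, map_add, add_smul]
  | mul_X p i hp =>
    have h : (X i : MvPolynomial (Fin 7) K) • socleMon K k = 0 := by
      refine quotient_eq_zero ?_ ?_ (fun j => ?_) fun k => ?_
      · simp [ptB_smul]
      · simp
      · simp
      · simp
    rw [mul_smul, h, smul_zero, mul_comm, evalOrigin_X_mul, zero_smul]

/-- The homomorphism `𝔞 → R/𝔞` with values in the local socle and given values on the quadratic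
relations. -/
noncomputable def socleHom (w : Fin 21 → Fin 7 → K) :
    aIdeal K →ₗ[MvPolynomial (Fin 7) K] MvPolynomial (Fin 7) K ⧸ aIdeal K where
  toFun f := ∑ k, (∑ j, w j k * hessian K (leadPair j).1 (leadPair j).2 f) • socleMon K k
  map_add' f g := by
    simp only [Submodule.coe_add, map_add, mul_add, Finset.sum_add_distrib, add_smul]
  map_smul' r f := by
    simp only [Submodule.coe_smul, smul_eq_mul, hessian_mul _ _ r f.2, RingHom.id_apply,
      Finset.smul_sum, smul_comm r, smul_socleMon r, smul_smul]
    refine Finset.sum_congr rfl fun k _ => ?_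
    rw [Finset.sum_mul]
    congr 1
    refine Finset.sum_congr rfl fun j _ => ?_
    ring

theorem socleHom_apply (w : Fin 21 → Fin 7 → K) (f : aIdeal K) :
    socleHom w f =
      ∑ k, (∑ j, w j k * hessian K (leadPair j).1 (leadPair j).2 f) • socleMon K k := rfl

theorem homCoords_derHom (t s : Fin 7 → K) :
    (homCoords K (derHom fun i => t i • localIdem K + s i • pointIdem K)).2 = (t, s) := by
  have hD : ∀ i l, hessianRel (normPair i).2 l (leadPair (normPair i).1).1
      (leadPair (normPair i).1).2 = if l = i then 1 else 0 := by decide +kernel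
  refine Prod.ext (funext fun i => ?_) (funext fun i => ?_)
  · rw [homCoords_snd_fst, derHom_apply, c1B_mk]
    have h (j : Fin 7) (l : Fin 7) (g : MvPolynomial (Fin 7) K) :
        linCoord K j ((t l • localIdem K + s l • pointIdem K) * g) = t l * linCoord K j g := by
      simp [localIdem, pointIdem, add_mul, mul_assoc]
    rw [map_sum]
    simp only [h, ← hessian_apply, hessian_localMap_quadRel, hD]
    simp
  · rw [homCoords_snd_snd, derHom_apply, ptB_mk, coe_pointMap, coe_pointRel]
    have h : evalPoint K (X i - C (reducedPoint i : K)) = 0 := by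
      rw [map_sub, evalPoint_X, evalPoint_C, sub_self]
    simp only [map_sum, evalPoint_mul, pderiv_mul, map_add, h, map_sub, pderiv_X, pderiv_C]
    simp [Pi.single_apply, apply_ite (evalPoint K)]

theorem homCoords_socleHom (w : Fin 21 → Fin 7 → K) :
    homCoords K (socleHom fun j k => w j k *
      (hessianRel (leadPair j).1 (leadPair j).2 (leadPair j).1 (leadPair j).2 : K)⁻¹) =
      (w, 0, 0) := by
  have hD : ∀ i j, i ≠ j → hessianRel (leadPair i).1 (leadPair i).2
      (leadPair j).1 (leadPair j).2 = 0 := by decide +kernel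
  have hD' : ∀ i, hessianRel (leadPair i).1 (leadPair i).2
      (leadPair i).1 (leadPair i).2 ≠ 0 := by decide +kernel
  refine Prod.ext (funext₂ fun j k => ?_)
    (Prod.ext (funext fun i => ?_) (funext fun i => ?_))
  · rw [homCoords_fst, socleHom_apply]
    simp only [hessian_localMap_quadRel, map_sum, map_smul, c2B_socleMon]
    simp only [smul_eq_mul, mul_ite, mul_one, mul_zero, Finset.sum_ite_eq', Finset.mem_univ,
      if_true]
    rw [Finset.sum_eq_single j]
    · rw [mul_assoc, inv_mul_cancel₀ (Int.cast_ne_zero.2 (hD' j)), mul_one]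
    · intro i _ hij
      rw [hD i j hij, Int.cast_zero, mul_zero]
    · simp
  · rw [homCoords_snd_fst, socleHom_apply]
    simp
  · rw [homCoords_snd_snd, socleHom_apply]
    simp

theorem homCoords_surjective : Function.Surjective (homCoords K) := by
  rintro ⟨w, t, s⟩
  obtain ⟨g, w', hg⟩ : ∃ g w', homCoords K g = (w', t, s) :=
    ⟨_, _, Prod.ext rfl (homCoords_derHom t s)⟩
  refine ⟨g + socleHom fun j k => (w - w') j k *
    (hessianRel (leadPair j).1 (leadPair j).2 (leadPair j).1 (leadPair j).2 : K)⁻¹, ?_⟩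
  rw [map_add, hg, homCoords_socleHom]
  simp

variable (K) in
theorem finrank_hom :
    Module.finrank K
      (aIdeal K →ₗ[MvPolynomial (Fin 7) K] MvPolynomial (Fin 7) K ⧸ aIdeal K) = 161 := by
  rw [(LinearEquiv.ofBijective (homCoords K)
    ⟨homCoords_injective, homCoords_surjective⟩).finrank_eq]
  simp [Module.finrank_pi_fintype]

end Coordinates

/-- (i) the residue classes of the 16 monomials form a `K`-basis of `R/𝔞`
(in particular `dim_K R/𝔞 = 16`); and (ii) `Hom_R(𝔞, R/𝔞)` has `K`-dimension `161`. -/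
theorem aIdeal_basis_and_tangent (K : Type) [Field K] [CharZero K] :
    ∀ a : Ideal (MvPolynomial (Fin 7) K), a = Ideal.span (aGens K) →
      LinearIndependent K (fun i => Ideal.Quotient.mk a (mons16 K i)) ∧
      Submodule.span K (Set.range (fun i => Ideal.Quotient.mk a (mons16 K i))) = ⊤ ∧
      Module.finrank K (MvPolynomial (Fin 7) K ⧸ a) = 16 ∧
      Module.finrank K (a →ₗ[MvPolynomial (Fin 7) K] (MvPolynomial (Fin 7) K ⧸ a)) = 161 := by
  rintro _ rfl
  exact ⟨linearIndependent_mk_mons16 K, span_mk_mons16 K, finrank_quotient K, finrank_hom K⟩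
end
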